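/- Let t ≥ 3 and q ≥ 3, and suppose R_1, R_2 ≥ 0 are such that there exists ω ≥ 0 with (t−1)/t · (1 − 1/q^{t−1}) + ω ≤ (q−1)/q, R_1 < 1 − h( (t−1)/t · (1 − 1/q^{t−1}) + ω ), and R_2 < h(ω) − max(f_1(ω), f_2(ω)). Then (R_1, R_2) is an achievable rate pair for q-ary (t,2)-fingerprinting: for every ε > 0 there exists n_0 such that for every n ≥ n_0 there is an (n, ⌊q^{nR_1}⌋, ⌊q^{nR_2}⌋)_q two-level randomized code that is (t,2)-fingerprinting with ε-error. -/

import Mathlib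

/-- The `q`-ary entropy function `h(x) = −x log_q(x/(q−1)) − (1−x) log_q(1−x)`
(with the convention `h(0) = 0`, which holds automatically since `Real.logb q 0 = 0`). -/
noncomputable def qEntropy (q : ℕ) (x : ℝ) : ℝ :=
  -x * Real.logb q (x / ((q : ℝ) - 1)) - (1 - x) * Real.logb q (1 - x)

/-- `y` lies in the envelope of the fingerprints `x 0, …, x (t-1)`:
every coordinate of `y` matches the corresponding coordinate of some `x i`. -/
def InEnvelope {q n t : ℕ} (x : Fin t → Fin n → Fin q) (y : Fin n → Fin q) : Prop :=
  ∀ l, ∃ i, y l = x i l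

/-- An `(n,M₁,M₂)_q` two-level code: an encoder and two decoders
(`none` plays the role of the decoding-failure output `0`). -/
structure TwoLevelCode (q n M₁ M₂ : ℕ) where
  enc : Fin M₁ × Fin M₂ → Fin n → Fin q
  dec1 : (Fin n → Fin q) → Option (Fin M₁)
  dec2 : (Fin n → Fin q) → Option (Fin M₁ × Fin M₂)

/-- An `(n,M₁,M₂)_q` two-level randomized code: a finite set of keys (indexed by
`Fin κ`), a probability distribution `π` on the keys, and a two-level code for each key. -/
structure RandCode (q n M₁ M₂ : ℕ) where
  κ : ℕ
  π : Fin κ → ℝ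
  π_nonneg : ∀ k, 0 ≤ π k
  π_sum : ∑ k, π k = 1
  code : Fin κ → TwoLevelCode q n M₁ M₂

/-- An admissible strategy for a coalition of size `t`: a conditional probability
distribution `V(y | x₁,…,x_t)` supported on the envelope of `x₁,…,x_t`. -/
def Admissible {q n t : ℕ}
    (V : (Fin t → Fin n → Fin q) → (Fin n → Fin q) → ℝ) : Prop :=
  (∀ x y, 0 ≤ V x y) ∧ (∀ x, ∑ y, V x y = 1) ∧
  (∀ x y, ¬ InEnvelope x y → V x y = 0)

open scoped Classical in
/-- The group-tracing error probability `e₁(𝒞,𝒟₁,U,V)` for the coalition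
`U = {u 0, …, u (t-1)}` and strategy `V`: the probability (over the key and the
strategy) that the decoded group is not a group of a coalition member. -/
noncomputable def e1 {q n M₁ M₂ : ℕ} (𝒞 : RandCode q n M₁ M₂) {t : ℕ}
    (u : Fin t → Fin M₁ × Fin M₂)
    (V : (Fin t → Fin n → Fin q) → (Fin n → Fin q) → ℝ) : ℝ :=
  ∑ k, 𝒞.π k *
    ∑ y ∈ Finset.univ.filter
        (fun y : Fin n → Fin q => ¬ ∃ i, (𝒞.code k).dec1 y = some (u i).1),
      V (fun i => (𝒞.code k).enc (u i)) y

open scoped Classical in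
/-- The user-tracing error probability `e₂(𝒞,𝒟₂,U,V)`: the probability that the
decoded user is not a coalition member. -/
noncomputable def e2 {q n M₁ M₂ : ℕ} (𝒞 : RandCode q n M₁ M₂) {t : ℕ}
    (u : Fin t → Fin M₁ × Fin M₂)
    (V : (Fin t → Fin n → Fin q) → (Fin n → Fin q) → ℝ) : ℝ :=
  ∑ k, 𝒞.π k *
    ∑ y ∈ Finset.univ.filter
        (fun y : Fin n → Fin q => ¬ ∃ i, (𝒞.code k).dec2 y = some (u i)),
      V (fun i => (𝒞.code k).enc (u i)) y

/-- `(t₁,t₂)`-fingerprinting with `ε`-error: (a) for every coalition of size at most `t₂`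
(given as an injective tuple of users) and every admissible strategy, `e₂ ≤ ε`;
(b) for every coalition of size at most `t₁` and every admissible strategy, `e₁ ≤ ε`. -/
def IsFingerprinting {q n M₁ M₂ : ℕ} (𝒞 : RandCode q n M₁ M₂)
    (t₁ t₂ : ℕ) (ε : ℝ) : Prop :=
  (∀ t : ℕ, 0 < t → t ≤ t₂ → ∀ u : Fin t → Fin M₁ × Fin M₂, Function.Injective u →
    ∀ V : (Fin t → Fin n → Fin q) → (Fin n → Fin q) → ℝ, Admissible V →
      e2 𝒞 u V ≤ ε) ∧
  (∀ t : ℕ, 0 < t → t ≤ t₁ → ∀ u : Fin t → Fin M₁ × Fin M₂, Function.Injective u →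
    ∀ V : (Fin t → Fin n → Fin q) → (Fin n → Fin q) → ℝ, Admissible V →
      e1 𝒞 u V ≤ ε)

/-- The function `φ(ω,γ,α,β)` of the paper.  The convention that a term `c·h(z/c)`
vanishes for `c = 0` holds automatically since in Lean `z/0 = 0` and `0·h(0) = 0`. -/
noncomputable def phi (q : ℕ) (ω γ α β : ℝ) : ℝ :=
  (1 - γ) * qEntropy q (α / (1 - γ)) +
    (γ - β) * qEntropy q ((ω - α - β) / (γ - β)) +
    γ * qEntropy q (β / γ) +
    (ω - α) * Real.logb q (((q : ℝ) - 2) / ((q : ℝ) - 1)) -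
    β * Real.logb q ((q : ℝ) - 2)

/-- Admissibility constraints on the parameters `(ω,γ,α,β)` of `φ`. -/
def AdmissibleParams (ω γ α β : ℝ) : Prop :=
  0 ≤ γ ∧ γ ≤ 1 ∧ 0 ≤ α ∧ 0 ≤ β ∧ α ≤ 1 - γ ∧ β ≤ γ ∧ α + β ≤ ω ∧ ω - α ≤ γ

noncomputable def delta1 (q : ℕ) (ω : ℝ) : ℝ :=
  (1 - (1 - ω) ^ 2 - ω ^ 2 / ((q : ℝ) - 1)) / 2

noncomputable def delta2 (q : ℕ) (ω : ℝ) : ℝ :=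
  (1 - 1 / (q : ℝ)) / 2

/-- `f₁(ω)`: the supremum of `φ(ω,γ,α,β)` over admissible `(γ,α,β)` with
`ω² ≤ γ ≤ 1 − (1−ω)²` and `γ − β + α ≤ δ₁(ω)`. -/
noncomputable def f1 (q : ℕ) (ω : ℝ) : ℝ :=
  sSup {v : ℝ | ∃ γ α β : ℝ, AdmissibleParams ω γ α β ∧
    ω ^ 2 ≤ γ ∧ γ ≤ 1 - (1 - ω) ^ 2 ∧ γ - β + α ≤ delta1 q ω ∧
    v = phi q ω γ α β}

/-- `f₂(ω)`: the supremum of `φ(ω,γ,α,β)` over admissible `(γ,α,β)` with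
`ω(q−1)/q ≤ γ ≤ 1 − (1−ω)/q` and `γ − β + α ≤ δ₂(ω)`. -/
noncomputable def f2 (q : ℕ) (ω : ℝ) : ℝ :=
  sSup {v : ℝ | ∃ γ α β : ℝ, AdmissibleParams ω γ α β ∧
    ω * ((q : ℝ) - 1) / q ≤ γ ∧ γ ≤ 1 - (1 - ω) / q ∧ γ - β + α ≤ delta2 q ω ∧
    v = phi q ω γ α β}

section ProductExpectation

variable {ι Ω : Type*} [Fintype ι] [DecidableEq ι] [Fintype Ω]

/-- The expectation of `F` under the product of the weights `p i`. -/
noncomputable def prodE (p : ι → Ω → ℝ) (F : (ι → Ω) → ℝ) : ℝ :=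
  ∑ k, (∏ i, p i (k i)) * F k

lemma prodE_prod (p g : ι → Ω → ℝ) :
    prodE p (fun k => ∏ i, g i (k i)) = ∏ i, ∑ a, p i a * g i a := by
  rw [Finset.prod_univ_sum, Fintype.piFinset_univ]
  simp only [prodE, Finset.prod_mul_distrib]

lemma sum_prod_weights {p : ι → Ω → ℝ} (hp : ∀ i, ∑ a, p i a = 1) :
    ∑ k : ι → Ω, ∏ i, p i (k i) = 1 := by
  have := prodE_prod p (fun _ _ => 1)
  simpa [prodE, hp] using this

lemma prodE_const {p : ι → Ω → ℝ} (hp : ∀ i, ∑ a, p i a = 1) (c : ℝ) :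
    prodE p (fun _ => c) = c := by
  rw [prodE, ← Finset.sum_mul, sum_prod_weights hp, one_mul]

lemma prodE_mono {p : ι → Ω → ℝ} (hp : ∀ i a, 0 ≤ p i a) {F G : (ι → Ω) → ℝ}
    (h : ∀ k, F k ≤ G k) : prodE p F ≤ prodE p G :=
  Finset.sum_le_sum fun k _ =>
    mul_le_mul_of_nonneg_left (h k) (Finset.prod_nonneg fun i _ => hp i _)

lemma prodE_add (p : ι → Ω → ℝ) (F G : (ι → Ω) → ℝ) :
    prodE p (fun k => F k + G k) = prodE p F + prodE p G := by
  simp only [prodE, mul_add, Finset.sum_add_distrib]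

lemma prodE_sum {σ : Type*} (S : Finset σ) (p : ι → Ω → ℝ) (F : σ → (ι → Ω) → ℝ) :
    prodE p (fun k => ∑ j ∈ S, F j k) = ∑ j ∈ S, prodE p (F j) := by
  simp only [prodE, Finset.mul_sum]
  exact Finset.sum_comm

lemma prodE_const_mul (p : ι → Ω → ℝ) (c : ℝ) (F : (ι → Ω) → ℝ) :
    prodE p (fun k => c * F k) = c * prodE p F := by
  simp only [prodE, Finset.mul_sum]
  exact Finset.sum_congr rfl fun k _ => by ring

lemma prodE_resample {p : ι → Ω → ℝ} (hp : ∀ i, ∑ a, p i a = 1) (i : ι)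
    (F : (ι → Ω) → ℝ) :
    prodE p F = prodE p (fun k => ∑ a, p i a * F (Function.update k i a)) := by
  have h1 : prodE p F = ∑ x : (ι → Ω) × Ω, (∏ j, p j (x.1 j)) * p i x.2 * F x.1 := by
    rw [Fintype.sum_prod_type]
    refine Finset.sum_congr rfl fun k _ => ?_
    dsimp only
    rw [← Finset.sum_mul, ← Finset.mul_sum, hp, mul_one]
  have h2 : prodE p (fun k => ∑ a, p i a * F (Function.update k i a)) =
      ∑ x : (ι → Ω) × Ω,
        (∏ j, p j (x.1 j)) * p i x.2 * F (Function.update x.1 i x.2) := by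
    rw [Fintype.sum_prod_type]
    refine Finset.sum_congr rfl fun k _ => ?_
    rw [Finset.mul_sum]
    exact Finset.sum_congr rfl fun a _ => by ring
  rw [h1, h2]
  let e : (ι → Ω) × Ω → (ι → Ω) × Ω := fun x => (Function.update x.1 i x.2, x.1 i)
  have he : Function.Involutive e := by
    rintro ⟨k, a⟩
    simp [e]
  refine Finset.sum_nbij' e e (by simp) (by simp) (fun x _ => he x) (fun x _ => he x) ?_
  rintro ⟨k, a⟩ -
  simp only [e, Function.update_idem, Function.update_eq_self]
  congr 1
  rw [← Finset.mul_prod_erase _ _ (Finset.mem_univ i),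
    ← Finset.mul_prod_erase _ _ (Finset.mem_univ i)]
  have : ∏ j ∈ Finset.univ.erase i, p j (Function.update k i a j) =
      ∏ j ∈ Finset.univ.erase i, p j (k j) :=
    Finset.prod_congr rfl fun j hj => by
      rw [Function.update_of_ne (Finset.ne_of_mem_erase hj)]
  rw [this, Function.update_self]
  ring

lemma prodE_resample_const {p : ι → Ω → ℝ} (hp : ∀ i, ∑ a, p i a = 1) (i : ι)
    {F : (ι → Ω) → ℝ} {c : ℝ}
    (h : ∀ k, ∑ a, p i a * F (Function.update k i a) = c) : prodE p F = c := by
  rw [prodE_resample hp i, funext h, prodE_const hp]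

open scoped Classical in
/-- The probability of `A` under the product of the weights `p i`. -/
noncomputable def prodP (p : ι → Ω → ℝ) (A : (ι → Ω) → Prop) : ℝ :=
  prodE p (fun k => if A k then 1 else 0)

lemma prodP_mono {p : ι → Ω → ℝ} (hp : ∀ i a, 0 ≤ p i a) {A B : (ι → Ω) → Prop}
    (h : ∀ k, A k → B k) : prodP p A ≤ prodP p B :=
  prodE_mono hp fun k => by
    by_cases hA : A k
    · simp [hA, h k hA]
    · simp only [hA, if_false]; split_ifs <;> norm_num

lemma prodP_or_le {p : ι → Ω → ℝ} (hp : ∀ i a, 0 ≤ p i a) (A B : (ι → Ω) → Prop) :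
    prodP p (fun k => A k ∨ B k) ≤ prodP p A + prodP p B := by
  rw [prodP, prodP, prodP, ← prodE_add]
  exact prodE_mono hp fun k => by
    by_cases hA : A k <;> by_cases hB : B k <;> simp [hA, hB]

lemma prodP_exists_le {σ : Type*} [Fintype σ] {p : ι → Ω → ℝ} (hp : ∀ i a, 0 ≤ p i a)
    (A : σ → (ι → Ω) → Prop) :
    prodP p (fun k => ∃ j, A j k) ≤ ∑ j, prodP p (A j) := by
  classical
  simp only [prodP]
  rw [← prodE_sum]
  refine prodE_mono hp fun k => ?_
  split_ifs with h
  · obtain ⟨j, hj⟩ := h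
    refine le_trans (by simp [hj]) (Finset.single_le_sum
      (f := fun j => if A j k then (1 : ℝ) else 0) (fun i _ => ?_) (Finset.mem_univ j))
    split_ifs <;> norm_num
  · exact Finset.sum_nonneg fun i _ => by split_ifs <;> norm_num

lemma prodP_nonneg {p : ι → Ω → ℝ} (hp : ∀ i a, 0 ≤ p i a) (A : (ι → Ω) → Prop) :
    0 ≤ prodP p A :=
  Finset.sum_nonneg fun k _ => mul_nonneg (Finset.prod_nonneg fun i _ => hp i _)
    (by dsimp only; split_ifs <;> norm_num)

/-- Chebyshev's inequality for the number of occurrences of an event of probability at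
least `m` in independent trials. -/
lemma prodP_card_lt_le {n : ℕ} (hn : 0 < n) {P : Ω → ℝ} (hP0 : ∀ a, 0 ≤ P a)
    (hP : ∑ a, P a = 1) (A : Ω → Prop) [DecidablePred A] {m s : ℝ} (hs : 0 < s)
    (hm : m ≤ ∑ a, P a * (if A a then 1 else 0)) :
    prodP (fun _ : Fin n => P)
      (fun k => ((Finset.univ.filter fun l => A (k l)).card : ℝ) < n * (m - s)) ≤
        1 / (n * s ^ 2) := by
  classical
  set μ := ∑ a, P a * (if A a then (1 : ℝ) else 0) with hμ
  have hμ0 : 0 ≤ μ := Finset.sum_nonneg fun a _ => mul_nonneg (hP0 a) (by split_ifs <;> norm_num)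
  have hμ1 : μ ≤ 1 := by
    rw [← hP]
    exact Finset.sum_le_sum fun a _ => mul_le_of_le_one_right (hP0 a) (by split_ifs <;> norm_num)
  set g : Ω → ℝ := fun a => (if A a then 1 else 0) - μ with hg
  have hg0 : ∑ a, P a * g a = 0 := by
    simp only [hg, mul_sub, Finset.sum_sub_distrib, ← Finset.sum_mul, hP, ← hμ]; ring
  have hg1 : ∀ a, g a ^ 2 ≤ 1 := fun a => by
    simp only [hg]; split_ifs <;> nlinarith
  have hp0 : ∀ (_ : Fin n) a, 0 ≤ P a := fun _ => hP0
  have hp : ∀ _ : Fin n, ∑ a, P a = 1 := fun _ => hP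
  have hvar : prodE (fun _ : Fin n => P) (fun k => (∑ l, g (k l)) ^ 2) ≤ n := by
    have : ∀ l l' : Fin n, prodE (fun _ : Fin n => P) (fun k => g (k l) * g (k l')) ≤
        if l = l' then 1 else 0 := by
      intro l l'
      split_ifs with h
      · subst h
        refine (prodE_mono hp0 (G := fun _ => 1) fun k => ?_).trans_eq (prodE_const hp 1)
        rw [← sq]; exact hg1 _
      · refine (prodE_resample_const hp l fun k => ?_).le
        have hne : ∀ a, Function.update k l a l' = k l' := fun a =>
          Function.update_of_ne (Ne.symm h) _ _
        simp only [Function.update_self, hne, ← mul_assoc, ← Finset.sum_mul, hg0, zero_mul]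
    simp only [sq, Finset.sum_mul_sum]
    rw [prodE_sum]
    simp only [prodE_sum]
    refine (Finset.sum_le_sum fun l _ => Finset.sum_le_sum fun l' _ => this l l').trans ?_
    simp
  have hns : 0 < (n : ℝ) * s := by positivity
  have hmain : prodP (fun _ : Fin n => P)
      (fun k => ((Finset.univ.filter fun l => A (k l)).card : ℝ) < n * (m - s)) ≤
      prodE (fun _ : Fin n => P) (fun k => 1 / (n * s) ^ 2 * (∑ l, g (k l)) ^ 2) := by
    refine prodE_mono hp0 fun k => ?_
    split_ifs with h
    · have hsum : ∑ l, g (k l) = ((Finset.univ.filter fun l => A (k l)).card : ℝ) - n * μ := by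
        simp [hg, Finset.sum_sub_distrib]
      have hle : ∑ l, g (k l) ≤ -(n * s) := by
        rw [hsum]
        have : (n : ℝ) * m ≤ n * μ := by gcongr
        linarith
      rw [one_div, inv_mul_eq_div, one_le_div (by positivity)]
      nlinarith
    · positivity
  refine hmain.trans ?_
  rw [prodE_const_mul]
  calc 1 / (n * s) ^ 2 * prodE (fun _ : Fin n => P) (fun k => (∑ l, g (k l)) ^ 2)
      ≤ 1 / (n * s) ^ 2 * n := by gcongr
    _ = 1 / (n * s ^ 2) := by
      have : (n : ℝ) ≠ 0 := by positivity
      field_simp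

end ProductExpectation

section EntropyCounting

lemma mul_qEntropy_div {q : ℕ} (hq : 3 ≤ q) {c z : ℝ} (hz : 0 ≤ z) (hzc : z ≤ c) :
    c * qEntropy q (z / c) =
      (Real.negMulLog z + z * Real.log ((q : ℝ) - 1) + Real.negMulLog (c - z) -
        Real.negMulLog c) / Real.log q := by
  have hq' : (3 : ℝ) ≤ q := by exact_mod_cast hq
  have hlog : Real.log q ≠ 0 := (Real.log_pos (by linarith)).ne'
  have hq1 : (q : ℝ) - 1 ≠ 0 := by linarith
  rcases (hz.trans hzc).eq_or_lt with hc | hc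
  · have : z = 0 := le_antisymm (hc ▸ hzc) hz
    simp [← hc, this]
  have e1 : z * Real.log (z / c / ((q : ℝ) - 1)) =
      z * (Real.log z - Real.log c - Real.log ((q : ℝ) - 1)) := by
    rcases hz.eq_or_lt with h0 | h0
    · simp [← h0]
    · rw [Real.log_div (by positivity) hq1, Real.log_div h0.ne' hc.ne']
  have e2 : (c - z) * Real.log (1 - z / c) = (c - z) * (Real.log (c - z) - Real.log c) := by
    rcases hzc.eq_or_lt with h0 | h0
    · simp [h0]
    · rw [show 1 - z / c = (c - z) / c by field_simp,
        Real.log_div (sub_pos.2 h0).ne' hc.ne']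
  have e3 : c * qEntropy q (z / c) = (-(z * Real.log (z / c / ((q : ℝ) - 1))) -
      (c - z) * Real.log (1 - z / c)) / Real.log q := by
    simp only [qEntropy, Real.logb]
    field_simp
  rw [e3, e1, e2]
  simp only [Real.negMulLog]
  congr 1
  ring

lemma pow_mul_pow_eq_rpow_qEntropy {q : ℕ} (hq : 3 ≤ q) {k N : ℕ} (hk : k ≤ N) :
    ((k : ℝ) / N / ((q : ℝ) - 1)) ^ k * (1 - (k : ℝ) / N) ^ (N - k) =
      (q : ℝ) ^ (-((N : ℝ) * qEntropy q ((k : ℝ) / N))) := by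
  have hq' : (3 : ℝ) ≤ q := by exact_mod_cast hq
  have hlog : Real.log q ≠ 0 := (Real.log_pos (by linarith)).ne'
  have hq1 : 0 < (q : ℝ) - 1 := by linarith
  have hk' : (k : ℝ) ≤ N := by exact_mod_cast hk
  rw [mul_qEntropy_div hq (Nat.cast_nonneg k) hk', Real.rpow_def_of_pos (by linarith)]
  have hexp : ∀ {x : ℝ} (m : ℕ), 0 < x → x ^ m = Real.exp (m * Real.log x) := by
    intro x m hx
    rw [Real.exp_nat_mul, Real.exp_log hx]
  have hfin : Real.log q * -((Real.negMulLog (k : ℝ) + k * Real.log ((q : ℝ) - 1) +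
      Real.negMulLog ((N : ℝ) - k) - Real.negMulLog (N : ℝ)) / Real.log q) =
      k * Real.log k - k * Real.log ((q : ℝ) - 1) +
        ((N : ℝ) - k) * Real.log ((N : ℝ) - k) - N * Real.log N := by
    simp only [Real.negMulLog]
    field_simp
    ring
  rw [hfin]
  rcases Nat.eq_zero_or_pos N with hN | hN
  · have : k = 0 := by omega
    simp [hN, this]
  have hN' : (0 : ℝ) < N := by exact_mod_cast hN
  have e1 : ((k : ℝ) / N / ((q : ℝ) - 1)) ^ k =
      Real.exp (k * (Real.log k - Real.log N - Real.log ((q : ℝ) - 1))) := by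
    rcases Nat.eq_zero_or_pos k with h0 | h0
    · simp [h0]
    · have h0' : (0 : ℝ) < k := by exact_mod_cast h0
      rw [hexp k (by positivity), Real.log_div (by positivity) hq1.ne',
        Real.log_div h0'.ne' hN'.ne']
  have e2 : (1 - (k : ℝ) / N) ^ (N - k) =
      Real.exp (((N : ℝ) - k) * (Real.log ((N : ℝ) - k) - Real.log N)) := by
    rcases hk.eq_or_lt with h0 | h0
    · simp [h0]
    · have h0' : (0 : ℝ) < (N : ℝ) - k := sub_pos.2 (by exact_mod_cast h0)
      rw [show 1 - (k : ℝ) / N = ((N : ℝ) - k) / N by field_simp,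
        hexp _ (by positivity), Real.log_div h0'.ne' hN'.ne', Nat.cast_sub hk]
  rw [e1, e2, ← Real.exp_add]
  congr 1
  ring

lemma sum_ite_eq_const {q : ℕ} (c : Fin q) (u v : ℝ) :
    ∑ a : Fin q, (if a = c then u else v) = u + ((q : ℝ) - 1) * v := by
  have : ∀ a : Fin q, (if a = c then u else v) = v + if a = c then u - v else 0 := by
    intro a; split_ifs <;> ring
  simp only [this, Finset.sum_add_distrib, Finset.sum_ite_eq', Finset.mem_univ, if_true]
  simp
  ring

lemma sum_ite_eq_ite_eq_const {q : ℕ} {c d : Fin q} (hcd : c ≠ d) (u v w : ℝ) :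
    ∑ a : Fin q, (if a = c then u else if a = d then v else w) =
      u + v + ((q : ℝ) - 2) * w := by
  have : ∀ a : Fin q, (if a = c then u else if a = d then v else w) =
      (if a = c then u - w else 0) + if a = d then v else w := by
    intro a
    by_cases h1 : a = c
    · subst h1; simp [hcd]
    · simp [h1]
  simp only [this, Finset.sum_add_distrib, Finset.sum_ite_eq', Finset.mem_univ, if_true]
  rw [sum_ite_eq_const]
  ring

lemma prod_ite_one_eq_pow {n : ℕ} (P : Fin n → Prop) [DecidablePred P] (u : ℝ) :
    ∏ l, (if P l then u else 1) = u ^ (Finset.univ.filter P).card := by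
  simp [Finset.prod_ite]

/-- The probability that a uniformly random word lies in a Hamming ball of relative
radius `ρ`. -/
lemma uniform_ball_le {q n : ℕ} (hq : 3 ≤ q) (y : Fin n → Fin q) {ρ : ℝ} (hρ0 : 0 < ρ)
    (hρ : ρ ≤ ((q : ℝ) - 1) / q) :
    ∑ a : Fin n → Fin q, (∏ _l : Fin n, 1 / (q : ℝ)) *
      (if (hammingDist a y : ℝ) ≤ ρ * n then 1 else 0) ≤
        (q : ℝ) ^ (-((n : ℝ) * (1 - qEntropy q ρ))) := by
  have hq' : (3 : ℝ) ≤ q := by exact_mod_cast hq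
  have hq1 : 0 < (q : ℝ) - 1 := by linarith
  have hq0 : 0 < (q : ℝ) := by linarith
  have hρq : ρ * q ≤ q - 1 := by rwa [le_div_iff₀ hq0] at hρ
  have hρ1 : 0 < 1 - ρ := by nlinarith
  have hle : ρ / ((q : ℝ) - 1) ≤ 1 - ρ := by rw [div_le_iff₀ hq1]; nlinarith
  have hr : 0 < ρ / ((q : ℝ) - 1) := by positivity
  have hent : -((n : ℝ) * qEntropy q ρ) = (ρ * n) * Real.logb q (ρ / ((q : ℝ) - 1)) +
      (n - ρ * n) * Real.logb q (1 - ρ) := by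
    simp only [qEntropy]; ring
  have hlb : ∀ a : Fin n → Fin q, (hammingDist a y : ℝ) ≤ ρ * n →
      (q : ℝ) ^ (-((n : ℝ) * qEntropy q ρ)) ≤
        ∏ l, (if a l = y l then 1 - ρ else ρ / ((q : ℝ) - 1)) := by
    intro a ha
    have hsplit : ∏ l, (if a l = y l then 1 - ρ else ρ / ((q : ℝ) - 1)) =
        (q : ℝ) ^ ((hammingDist a y : ℝ) * Real.logb q (ρ / ((q : ℝ) - 1)) +
          (n - hammingDist a y) * Real.logb q (1 - ρ)) := by
      have hcard := Finset.card_filter_add_card_filter_not (s := (Finset.univ : Finset (Fin n)))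
        (fun l => a l = y l)
      rw [Finset.card_univ, Fintype.card_fin] at hcard
      have hd : (Finset.univ.filter fun l => ¬ a l = y l).card = hammingDist a y := rfl
      rw [hd] at hcard
      have hcard' : ((Finset.univ.filter fun l => a l = y l).card : ℝ) =
          n - hammingDist a y := by
        rw [eq_sub_iff_add_eq]; exact_mod_cast hcard
      rw [Finset.prod_ite, Finset.prod_const, Finset.prod_const, hd, Real.rpow_add hq0,
        mul_comm (hammingDist a y : ℝ), mul_comm ((n : ℝ) - _), Real.rpow_mul hq0.le,
        Real.rpow_mul hq0.le, Real.rpow_logb hq0 (by linarith) hr,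
        Real.rpow_logb hq0 (by linarith) hρ1, ← hcard', Real.rpow_natCast, Real.rpow_natCast]
      ring
    rw [hsplit, hent]
    refine Real.rpow_le_rpow_of_exponent_le (by linarith) ?_
    have := Real.logb_le_logb_of_le (b := (q : ℝ)) (by linarith) hr hle
    nlinarith
  have hsum : ∑ a : Fin n → Fin q,
      ∏ l, (if a l = y l then 1 - ρ else ρ / ((q : ℝ) - 1)) = 1 := by
    have := Finset.prod_univ_sum (fun _ : Fin n => (Finset.univ : Finset (Fin q)))
      (fun l a => if a = y l then 1 - ρ else ρ / ((q : ℝ) - 1))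
    rw [Fintype.piFinset_univ] at this
    rw [← this]
    refine Finset.prod_eq_one fun l _ => ?_
    rw [sum_ite_eq_const]
    field_simp
    ring
  have hpow : (q : ℝ) ^ (-((n : ℝ) * (1 - qEntropy q ρ))) =
      (∏ _l : Fin n, 1 / (q : ℝ)) * (q : ℝ) ^ ((n : ℝ) * qEntropy q ρ) := by
    rw [Finset.prod_const, Finset.card_univ, Fintype.card_fin, one_div, inv_pow,
      ← Real.rpow_natCast, ← Real.rpow_neg hq0.le, ← Real.rpow_add hq0]
    congr 1; ring
  rw [← Finset.mul_sum, hpow]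
  refine mul_le_mul_of_nonneg_left ?_ (Finset.prod_nonneg fun _ _ => by positivity)
  have hE : (q : ℝ) ^ ((n : ℝ) * qEntropy q ρ) * (q : ℝ) ^ (-((n : ℝ) * qEntropy q ρ)) = 1 := by
    rw [← Real.rpow_add hq0]; simp
  have hEpos : 0 < (q : ℝ) ^ ((n : ℝ) * qEntropy q ρ) := Real.rpow_pos_of_pos hq0 _
  calc ∑ a : Fin n → Fin q, (if (hammingDist a y : ℝ) ≤ ρ * n then (1 : ℝ) else 0)
      ≤ ∑ a : Fin n → Fin q, (q : ℝ) ^ ((n : ℝ) * qEntropy q ρ) *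
          ∏ l, (if a l = y l then 1 - ρ else ρ / ((q : ℝ) - 1)) := by
        refine Finset.sum_le_sum fun a _ => ?_
        split_ifs with h
        · exact hE.ge.trans (mul_le_mul_of_nonneg_left (hlb a h) hEpos.le)
        · exact mul_nonneg hEpos.le (Finset.prod_nonneg fun l _ => by split_ifs <;> linarith)
    _ = _ := by rw [← Finset.mul_sum, hsum, mul_one]

end EntropyCounting

section TypeCounting

variable {q n : ℕ} [NeZero q]

/-- The number of coordinates where `b` vanishes and `a` does not. -/
def countOff (b a : Fin n → Fin q) : ℕ :=
  (Finset.univ.filter fun l => b l = 0 ∧ a l ≠ 0).card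

/-- The number of coordinates where `b` does not vanish and `a` agrees with `b`. -/
def countAgree (b a : Fin n → Fin q) : ℕ :=
  (Finset.univ.filter fun l => b l ≠ 0 ∧ a l = b l).card

/-- The number of coordinates where `a` and `b` are nonzero and differ. -/
def countDiffer (b a : Fin n → Fin q) : ℕ :=
  (Finset.univ.filter fun l => b l ≠ 0 ∧ a l ≠ b l ∧ a l ≠ 0).card

lemma card_filter_split {σ : Type*} (S : Finset σ) (P R : σ → Prop) [DecidablePred P]
    [DecidablePred R] :
    (S.filter P).card =
      (S.filter fun l => P l ∧ R l).card + (S.filter fun l => P l ∧ ¬ R l).card := by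
  rw [← Finset.card_filter_add_card_filter_not (s := S.filter P) R, Finset.filter_filter,
    Finset.filter_filter]

lemma card_zero_add_hammingNorm (b : Fin n → Fin q) :
    (Finset.univ.filter fun l => b l = 0).card + hammingNorm b = n := by
  have := Finset.card_filter_add_card_filter_not (s := (Finset.univ : Finset (Fin n)))
    (fun l => b l = 0)
  rwa [Finset.card_univ, Fintype.card_fin] at this

lemma card_zero_zero_add_countOff (b a : Fin n → Fin q) :
    (Finset.univ.filter fun l => b l = 0 ∧ a l = 0).card + countOff b a =
      (Finset.univ.filter fun l => b l = 0).card :=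
  (card_filter_split _ _ _).symm

lemma countAgree_add_countDiffer_add (b a : Fin n → Fin q) :
    countAgree b a + countDiffer b a +
      (Finset.univ.filter fun l => b l ≠ 0 ∧ a l ≠ b l ∧ a l = 0).card = hammingNorm b := by
  have h1 := card_filter_split Finset.univ (fun l => b l ≠ 0) (fun l => a l = b l)
  have h2 := card_filter_split Finset.univ (fun l => b l ≠ 0 ∧ ¬ a l = b l) (fun l => a l = 0)
  simp only [and_assoc, ne_eq] at h1 h2
  simp only [countAgree, countDiffer, hammingNorm, ne_eq]
  omega

lemma hammingNorm_eq_counts (b a : Fin n → Fin q) :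
    hammingNorm a = countOff b a + countAgree b a + countDiffer b a := by
  have h1 := card_filter_split Finset.univ (fun l => a l ≠ 0) (fun l => b l = 0)
  have h2 := card_filter_split Finset.univ (fun l => a l ≠ 0 ∧ ¬ b l = 0) (fun l => a l = b l)
  have e1 : countOff b a = (Finset.univ.filter fun l => a l ≠ 0 ∧ b l = 0).card := by
    simp only [countOff, and_comm]
  have e2 : countAgree b a =
      (Finset.univ.filter fun l => (a l ≠ 0 ∧ ¬ b l = 0) ∧ a l = b l).card := by
    unfold countAgree
    congr 1; ext l; simp only [Finset.mem_filter, Finset.mem_univ, true_and]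
    constructor
    · rintro ⟨h, h'⟩; exact ⟨⟨h' ▸ h, h⟩, h'⟩
    · rintro ⟨⟨_, h⟩, h'⟩; exact ⟨h, h'⟩
  have e3 : countDiffer b a =
      (Finset.univ.filter fun l => (a l ≠ 0 ∧ ¬ b l = 0) ∧ ¬ a l = b l).card := by
    unfold countDiffer
    congr 1; ext l; simp only [Finset.mem_filter, Finset.mem_univ, true_and]; tauto
  rw [e1, e2, e3]
  simp only [hammingNorm]
  omega

lemma hammingDist_add_countAgree (b a : Fin n → Fin q) :
    hammingDist a b + countAgree b a = countOff b a + hammingNorm b := by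
  have h1 := card_filter_split Finset.univ (fun l => a l ≠ b l) (fun l => b l = 0)
  have h2 := card_filter_split Finset.univ (fun l => b l ≠ 0) (fun l => a l = b l)
  have e1 : countOff b a = (Finset.univ.filter fun l => a l ≠ b l ∧ b l = 0).card := by
    unfold countOff
    congr 1; ext l; simp only [Finset.mem_filter, Finset.mem_univ, true_and]
    constructor
    · rintro ⟨h, h'⟩; exact ⟨h ▸ h', h⟩
    · rintro ⟨h, h'⟩; exact ⟨h', h' ▸ h⟩
  have e2 : (Finset.univ.filter fun l => b l ≠ 0 ∧ ¬ a l = b l).card =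
      (Finset.univ.filter fun l => a l ≠ b l ∧ ¬ b l = 0).card := by
    simp only [ne_eq, and_comm]
  simp only [countAgree, hammingDist, hammingNorm] at *
  omega

lemma prod_typeWeights (b a : Fin n → Fin q) (u₁ u₂ v₁ v₂ v₃ : ℝ) :
    ∏ l, (if b l = 0 then (if a l = 0 then u₁ else u₂)
        else if a l = b l then v₁ else if a l = 0 then v₂ else v₃) =
      u₁ ^ (Finset.univ.filter fun l => b l = 0 ∧ a l = 0).card * u₂ ^ countOff b a *
        v₁ ^ countAgree b a *
        v₂ ^ (Finset.univ.filter fun l => b l ≠ 0 ∧ a l ≠ b l ∧ a l = 0).card *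
        v₃ ^ countDiffer b a := by
  simp only [countOff, countAgree, countDiffer]
  rw [← prod_ite_one_eq_pow, ← prod_ite_one_eq_pow, ← prod_ite_one_eq_pow,
    ← prod_ite_one_eq_pow, ← prod_ite_one_eq_pow, ← Finset.prod_mul_distrib,
    ← Finset.prod_mul_distrib, ← Finset.prod_mul_distrib, ← Finset.prod_mul_distrib]
  refine Finset.prod_congr rfl fun l _ => ?_
  generalize b l = x
  generalize a l = y
  by_cases h1 : x = 0
  · by_cases h2 : y = 0 <;> simp [h1, h2]
  · by_cases h3 : y = x
    · simp [h1, h3]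
    · by_cases h2 : y = 0
      · simp only [h2] at h3
        simp [h1, h2, h3]
      · simp [h1, h2, h3]

/-- The number of words of a given joint type with `b` is at most `q ^ (n φ)`. -/
lemma card_type_le (hq : 3 ≤ q) (hn : 0 < n) (b a₀ : Fin n → Fin q) :
    ((Finset.univ.filter fun a : Fin n → Fin q =>
      countOff b a = countOff b a₀ ∧ countAgree b a = countAgree b a₀ ∧
        countDiffer b a = countDiffer b a₀).card : ℝ) ≤
      (q : ℝ) ^ ((n : ℝ) * phi q ((hammingNorm a₀ : ℝ) / n) ((hammingNorm b : ℝ) / n)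
        ((countOff b a₀ : ℝ) / n) ((countAgree b a₀ : ℝ) / n)) := by
  have hq' : (3 : ℝ) ≤ q := by exact_mod_cast hq
  have hq1 : 0 < (q : ℝ) - 1 := by linarith
  have hq2 : 0 < (q : ℝ) - 2 := by linarith
  have hq0 : 0 < (q : ℝ) := by linarith
  have hn' : (0 : ℝ) < n := by exact_mod_cast hn
  have hG := card_zero_add_hammingNorm b
  have hA := card_zero_zero_add_countOff b a₀
  have hBC := countAgree_add_countDiffer_add b a₀
  have hw := hammingNorm_eq_counts b a₀
  set A := countOff b a₀
  set B := countAgree b a₀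
  set C := countDiffer b a₀
  set G := hammingNorm b
  set N := (Finset.univ.filter fun l => b l = 0).card
  have hNG : (N : ℝ) + G = n := by exact_mod_cast hG
  set x₁ : ℝ := (A : ℝ) / N
  set x₂ : ℝ := (B : ℝ) / G
  set x₃ : ℝ := (C : ℝ) / ((G - B : ℕ) : ℝ)
  have hx : ∀ {k m : ℕ}, k ≤ m → 0 ≤ 1 - (k : ℝ) / m := fun {k m} h => by
    rw [sub_nonneg]
    exact div_le_one_of_le₀ (by exact_mod_cast h) (Nat.cast_nonneg m)
  have hx₁ : 0 ≤ 1 - x₁ := hx (by omega)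
  have hx₂ : 0 ≤ 1 - x₂ := hx (by omega)
  have hx₃ : 0 ≤ 1 - x₃ := hx (by omega)
  have hx₁' : 0 ≤ x₁ := by positivity
  have hx₂' : 0 ≤ x₂ := by positivity
  have hx₃' : 0 ≤ x₃ := by positivity
  let W : Fin n → Fin q → ℝ := fun l c =>
    if b l = 0 then (if c = 0 then 1 - x₁ else x₁ / ((q : ℝ) - 1))
    else if c = b l then x₂ else if c = 0 then (1 - x₂) * (1 - x₃)
      else (1 - x₂) * (x₃ / ((q : ℝ) - 2))
  have hW0 : ∀ l c, 0 ≤ W l c := by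
    intro l c
    simp only [W]
    split_ifs <;> positivity
  have hWsum : ∑ a : Fin n → Fin q, ∏ l, W l (a l) = 1 := by
    have := Finset.prod_univ_sum (fun _ : Fin n => (Finset.univ : Finset (Fin q))) W
    rw [Fintype.piFinset_univ] at this
    rw [← this]
    refine Finset.prod_eq_one fun l _ => ?_
    simp only [W]
    by_cases hb : b l = 0
    · simp only [hb, if_true]
      rw [sum_ite_eq_const]
      field_simp
      ring
    · simp only [hb, if_false]
      rw [sum_ite_eq_ite_eq_const hb]
      field_simp
      ring
  have hphi : (q : ℝ) ^ (-((n : ℝ) * phi q ((hammingNorm a₀ : ℝ) / n) ((G : ℝ) / n)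
      ((A : ℝ) / n) ((B : ℝ) / n))) =
      (q : ℝ) ^ (-((N : ℝ) * qEntropy q x₁)) * (q : ℝ) ^ (-((G : ℝ) * qEntropy q x₂)) *
      (q : ℝ) ^ (-(((G - B : ℕ) : ℝ) * qEntropy q x₃)) *
      (((q : ℝ) - 1) ^ B * (((q : ℝ) - 1) / ((q : ℝ) - 2)) ^ C) := by
    have hGB : ((G - B : ℕ) : ℝ) = (G : ℝ) - B := Nat.cast_sub (by omega)
    have e1 : 1 - (G : ℝ) / n = N / n := by field_simp; linarith
    have e2 : (A : ℝ) / n / (N / n) = x₁ := div_div_div_cancel_right₀ hn'.ne' _ _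
    have e3 : (G : ℝ) / n - B / n = ((G - B : ℕ) : ℝ) / n := by rw [hGB]; ring
    have e4 : ((hammingNorm a₀ : ℝ) / n - A / n - B / n) / (((G - B : ℕ) : ℝ) / n) = x₃ := by
      rw [← sub_div, ← sub_div, div_div_div_cancel_right₀ hn'.ne', hw]
      push_cast
      congr 1; ring
    have e5 : (B : ℝ) / n / ((G : ℝ) / n) = x₂ := div_div_div_cancel_right₀ hn'.ne' _ _
    have e6 : (((q : ℝ) - 1) ^ B * (((q : ℝ) - 1) / ((q : ℝ) - 2)) ^ C) =
        (q : ℝ) ^ (Real.logb q ((q : ℝ) - 1) * B +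
          Real.logb q (((q : ℝ) - 1) / ((q : ℝ) - 2)) * C) := by
      rw [Real.rpow_add hq0, Real.rpow_mul hq0.le, Real.rpow_mul hq0.le,
        Real.rpow_logb hq0 (by linarith) hq1,
        Real.rpow_logb hq0 (by linarith) (by positivity), Real.rpow_natCast, Real.rpow_natCast]
    rw [e6, ← Real.rpow_add hq0, ← Real.rpow_add hq0, ← Real.rpow_add hq0]
    congr 1
    simp only [phi]
    rw [e1, e2, e3, e4, e5, Real.logb_div hq1.ne' hq2.ne', Real.logb_div hq2.ne' hq1.ne', hw]
    push_cast
    field_simp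
    ring
  have hWa : ∀ a : Fin n → Fin q, countOff b a = A → countAgree b a = B →
      countDiffer b a = C → ∏ l, W l (a l) =
        (q : ℝ) ^ (-((n : ℝ) * phi q ((hammingNorm a₀ : ℝ) / n) ((G : ℝ) / n)
          ((A : ℝ) / n) ((B : ℝ) / n))) := by
    intro a h1 h2 h3
    have hA' := card_zero_zero_add_countOff b a
    have hBC' := countAgree_add_countDiffer_add b a
    have c1 : (Finset.univ.filter fun l => b l = 0 ∧ a l = 0).card = N - A := by omega
    have c2 : (Finset.univ.filter fun l => b l ≠ 0 ∧ a l ≠ b l ∧ a l = 0).card = G - B - C := by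
      omega
    simp only [W]
    rw [prod_typeWeights, h1, h2, h3, c1, c2, hphi,
      ← pow_mul_pow_eq_rpow_qEntropy hq (show A ≤ N by omega),
      ← pow_mul_pow_eq_rpow_qEntropy hq (show B ≤ G by omega),
      ← pow_mul_pow_eq_rpow_qEntropy hq (show C ≤ G - B by omega)]
    change (1 - x₁) ^ (N - A) * (x₁ / ((q : ℝ) - 1)) ^ A * x₂ ^ B *
        ((1 - x₂) * (1 - x₃)) ^ (G - B - C) * ((1 - x₂) * (x₃ / ((q : ℝ) - 2))) ^ C =
      (x₁ / ((q : ℝ) - 1)) ^ A * (1 - x₁) ^ (N - A) *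
        ((x₂ / ((q : ℝ) - 1)) ^ B * (1 - x₂) ^ (G - B)) *
        ((x₃ / ((q : ℝ) - 1)) ^ C * (1 - x₃) ^ (G - B - C)) *
        (((q : ℝ) - 1) ^ B * (((q : ℝ) - 1) / ((q : ℝ) - 2)) ^ C)
    rw [show (1 - x₂) ^ (G - B) = (1 - x₂) ^ (G - B - C) * (1 - x₂) ^ C by
      rw [← pow_add]; congr 1; omega]
    have f1 : x₂ ^ B = (x₂ / ((q : ℝ) - 1)) ^ B * ((q : ℝ) - 1) ^ B := by
      rw [← mul_pow, div_mul_cancel₀ _ hq1.ne']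
    have f2 : (x₃ / ((q : ℝ) - 2)) ^ C =
        (x₃ / ((q : ℝ) - 1)) ^ C * (((q : ℝ) - 1) / ((q : ℝ) - 2)) ^ C := by
      rw [← mul_pow, div_mul_div_cancel₀ hq1.ne']
    rw [mul_pow, mul_pow, f2, f1]
    ac_rfl
  have hE : (q : ℝ) ^ ((n : ℝ) * phi q ((hammingNorm a₀ : ℝ) / n) ((G : ℝ) / n)
      ((A : ℝ) / n) ((B : ℝ) / n)) * (q : ℝ) ^ (-((n : ℝ) * phi q ((hammingNorm a₀ : ℝ) / n)
      ((G : ℝ) / n) ((A : ℝ) / n) ((B : ℝ) / n))) = 1 := by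
    rw [← Real.rpow_add hq0]; simp
  set S := Finset.univ.filter fun a : Fin n → Fin q =>
    countOff b a = A ∧ countAgree b a = B ∧ countDiffer b a = C
  have hS : (S.card : ℝ) * (q : ℝ) ^ (-((n : ℝ) * phi q ((hammingNorm a₀ : ℝ) / n)
      ((G : ℝ) / n) ((A : ℝ) / n) ((B : ℝ) / n))) ≤ 1 := by
    rw [← hWsum, ← nsmul_eq_mul, ← Finset.sum_const]
    calc _ = ∑ a ∈ S, ∏ l, W l (a l) := Finset.sum_congr rfl fun a ha => by
            obtain ⟨h1, h2, h3⟩ := (Finset.mem_filter.1 ha).2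
            exact (hWa a h1 h2 h3).symm
      _ ≤ _ := Finset.sum_le_univ_sum_of_nonneg fun a => Finset.prod_nonneg fun l _ => hW0 l _
  have hpos := Real.rpow_pos_of_pos hq0 (-((n : ℝ) * phi q ((hammingNorm a₀ : ℝ) / n)
      ((G : ℝ) / n) ((A : ℝ) / n) ((B : ℝ) / n)))
  exact le_of_mul_le_mul_right (hS.trans_eq hE.symm) hpos

/-- The distribution of the noise separating a fingerprint symbol from the symbol of its
group center. -/
noncomputable def noise (q : ℕ) [NeZero q] (ω : ℝ) (a : Fin q) : ℝ :=
  if a = 0 then 1 - ω else ω / ((q : ℝ) - 1)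

lemma sum_noise (hq : 3 ≤ q) (ω : ℝ) : ∑ a, noise q ω a = 1 := by
  have hq' : (3 : ℝ) ≤ q := by exact_mod_cast hq
  have hq1 : (q : ℝ) - 1 ≠ 0 := by linarith
  simp only [noise]
  rw [sum_ite_eq_const]
  field_simp
  ring

lemma noise_nonneg (hq : 3 ≤ q) {ω : ℝ} (h0 : 0 ≤ ω) (h1 : ω ≤ 1) (a : Fin q) :
    0 ≤ noise q ω a := by
  have hq' : (3 : ℝ) ≤ q := by exact_mod_cast hq
  have hq1 : 0 < (q : ℝ) - 1 := by linarith
  unfold noise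
  split_ifs
  · linarith
  · positivity

lemma prod_noise_le (hq : 3 ≤ q) {ω s : ℝ} (h0 : 0 < ω) (h1 : ω < 1) (a : Fin n → Fin q)
    (ha : |(hammingNorm a : ℝ) - ω * n| ≤ s * n) :
    ∏ l, noise q ω (a l) ≤ (q : ℝ) ^ (-((n : ℝ) * (qEntropy q ω -
      s * |Real.logb q (ω / ((q : ℝ) - 1)) - Real.logb q (1 - ω)|))) := by
  have hq' : (3 : ℝ) ≤ q := by exact_mod_cast hq
  have hq1 : 0 < (q : ℝ) - 1 := by linarith
  have hq0 : 0 < (q : ℝ) := by linarith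
  have hcard := card_zero_add_hammingNorm a
  have hd : (Finset.univ.filter fun l => ¬ a l = 0).card = hammingNorm a := rfl
  have hcard' : ((Finset.univ.filter fun l => a l = 0).card : ℝ) = n - hammingNorm a := by
    rw [eq_sub_iff_add_eq]; exact_mod_cast hcard
  simp only [noise]
  rw [Finset.prod_ite, Finset.prod_const, Finset.prod_const, hd]
  have hsplit : (1 - ω) ^ (Finset.univ.filter fun l => a l = 0).card *
      (ω / ((q : ℝ) - 1)) ^ hammingNorm a =
      (q : ℝ) ^ (Real.logb q (1 - ω) * (n - hammingNorm a) +
        Real.logb q (ω / ((q : ℝ) - 1)) * hammingNorm a) := by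
    rw [Real.rpow_add hq0, Real.rpow_mul hq0.le, Real.rpow_mul hq0.le,
      Real.rpow_logb hq0 (by linarith) (by linarith),
      Real.rpow_logb hq0 (by linarith) (by positivity), ← hcard', Real.rpow_natCast,
      Real.rpow_natCast]
  rw [hsplit]
  refine Real.rpow_le_rpow_of_exponent_le (by linarith) ?_
  simp only [qEntropy]
  set L₁ := Real.logb q (ω / ((q : ℝ) - 1))
  set L₂ := Real.logb q (1 - ω)
  have : ((hammingNorm a : ℝ) - ω * n) * (L₁ - L₂) ≤ s * n * |L₁ - L₂| :=
    (le_abs_self _).trans (by rw [abs_mul]; gcongr)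
  linarith

/-- The probability that a word drawn from the noise distribution has typical weight and
lies close to a fixed word `b`. -/
lemma noise_ball_le (hq : 3 ≤ q) (hn : 0 < n) {ω s D M : ℝ} (h0 : 0 < ω) (h1 : ω < 1)
    (b : Fin n → Fin q)
    (hM : ∀ w α β : ℝ, AdmissibleParams w ((hammingNorm b : ℝ) / n) α β → |w - ω| ≤ s →
      (hammingNorm b : ℝ) / n - β + α ≤ D → phi q w ((hammingNorm b : ℝ) / n) α β ≤ M) :
    ∑ a : Fin n → Fin q, (∏ l, noise q ω (a l)) *
      (if |(hammingNorm a : ℝ) - ω * n| ≤ s * n ∧ (hammingDist a b : ℝ) ≤ D * n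
        then 1 else 0) ≤
      ((n : ℝ) + 1) ^ 3 * ((q : ℝ) ^ ((n : ℝ) * M) * (q : ℝ) ^ (-((n : ℝ) * (qEntropy q ω -
        s * |Real.logb q (ω / ((q : ℝ) - 1)) - Real.logb q (1 - ω)|)))) := by
  have hq' : (3 : ℝ) ≤ q := by exact_mod_cast hq
  have hq0 : 0 < (q : ℝ) := by linarith
  have hn' : (0 : ℝ) < n := by exact_mod_cast hn
  set E := (q : ℝ) ^ (-((n : ℝ) * (qEntropy q ω -
        s * |Real.logb q (ω / ((q : ℝ) - 1)) - Real.logb q (1 - ω)|)))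
  have hE : 0 ≤ E := (Real.rpow_pos_of_pos hq0 _).le
  let typ : (Fin n → Fin q) → ℕ × ℕ × ℕ := fun a =>
    (countOff b a, countAgree b a, countDiffer b a)
  let R := Finset.range (n + 1)
  have hmaps : ∀ a ∈ (Finset.univ : Finset (Fin n → Fin q)), typ a ∈ R ×ˢ R ×ˢ R := by
    intro a _
    have h : ∀ P : Fin n → Prop, ∀ [DecidablePred P], (Finset.univ.filter P).card < n + 1 :=
      fun P _ => Nat.lt_succ_of_le ((Finset.card_filter_le _ _).trans (by simp))
    simp only [typ, R, Finset.mem_product, Finset.mem_range]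
    exact ⟨h _, h _, h _⟩
  rw [← Finset.sum_fiberwise_of_maps_to hmaps]
  have hcardR : ((R ×ˢ R ×ˢ R).card : ℝ) = ((n : ℝ) + 1) ^ 3 := by
    simp only [R, Finset.card_product, Finset.card_range]
    push_cast; ring
  rw [← hcardR, ← nsmul_eq_mul]
  refine Finset.sum_le_card_nsmul _ _ _ fun τ _ => ?_
  set F := Finset.univ.filter fun a => typ a = τ
  by_cases hex : ∃ a₀ ∈ F, |(hammingNorm a₀ : ℝ) - ω * n| ≤ s * n ∧
      (hammingDist a₀ b : ℝ) ≤ D * n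
  · obtain ⟨a₀, ha₀, hw, hD⟩ := hex
    have hτ : typ a₀ = τ := (Finset.mem_filter.1 ha₀).2
    have hF : F = Finset.univ.filter fun a : Fin n → Fin q =>
        countOff b a = countOff b a₀ ∧ countAgree b a = countAgree b a₀ ∧
        countDiffer b a = countDiffer b a₀ := by
      simp only [F, ← hτ, typ, Prod.mk.injEq]
    have hG := card_zero_add_hammingNorm b
    have hA := card_zero_zero_add_countOff b a₀
    have hBC := countAgree_add_countDiffer_add b a₀
    have hw' := hammingNorm_eq_counts b a₀
    have hd := hammingDist_add_countAgree b a₀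
    have hcard : (F.card : ℝ) ≤ (q : ℝ) ^ ((n : ℝ) * M) := by
      rw [hF]
      refine (card_type_le hq hn b a₀).trans ?_
      refine Real.rpow_le_rpow_of_exponent_le (by linarith)
        (mul_le_mul_of_nonneg_left ?_ hn'.le)
      refine hM _ _ _ ⟨by positivity, ?_, by positivity, by positivity, ?_, ?_, ?_, ?_⟩ ?_ ?_
      · rw [div_le_one hn']; exact_mod_cast (by omega)
      · rw [one_sub_div hn'.ne', div_le_div_iff_of_pos_right hn', le_sub_iff_add_le]
        exact_mod_cast (by omega)
      · rw [div_le_div_iff_of_pos_right hn']; exact_mod_cast (by omega)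
      · rw [← add_div, div_le_div_iff_of_pos_right hn']; exact_mod_cast (by omega)
      · rw [← sub_div, div_le_div_iff_of_pos_right hn', sub_le_iff_le_add]
        exact_mod_cast (by omega)
      · rw [show (hammingNorm a₀ : ℝ) / n - ω = (hammingNorm a₀ - ω * n) / n by field_simp,
          abs_div, abs_of_pos hn', div_le_iff₀ hn']
        exact hw
      · rw [← sub_div, ← add_div, div_le_iff₀ hn']
        have : (hammingDist a₀ b : ℝ) + countAgree b a₀ = countOff b a₀ + hammingNorm b := by
          exact_mod_cast hd
        linarith
    calc _ ≤ ∑ a ∈ F, E := Finset.sum_le_sum fun a _ => by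
            split_ifs with h
            · rw [mul_one]; exact prod_noise_le hq h0 h1 a h.1
            · rw [mul_zero]; exact hE
      _ = F.card * E := by rw [Finset.sum_const, nsmul_eq_mul]
      _ ≤ _ := mul_le_mul_of_nonneg_right hcard hE
  · rw [Finset.sum_eq_zero]
    · exact mul_nonneg (Real.rpow_pos_of_pos hq0 _).le hE
    · intro a ha
      rw [if_neg fun h => hex ⟨a, ha, h⟩, mul_zero]

end TypeCounting

section Compactness

/-- The set of all admissible tuples `(ω, γ, α, β)`. -/
def admissibleSet : Set (ℝ × ℝ × ℝ × ℝ) :=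
  {p | AdmissibleParams p.1 p.2.1 p.2.2.1 p.2.2.2}

lemma isCompact_admissibleSet : IsCompact admissibleSet := by
  have hbox : IsCompact (Set.Icc (0 : ℝ) 2 ×ˢ Set.Icc (0 : ℝ) 1 ×ˢ Set.Icc (0 : ℝ) 1 ×ˢ
      Set.Icc (0 : ℝ) 1) :=
    isCompact_Icc.prod (isCompact_Icc.prod (isCompact_Icc.prod isCompact_Icc))
  refine hbox.of_isClosed_subset ?_ ?_
  · simp only [admissibleSet, AdmissibleParams, Set.ofPred_and]
    refine IsClosed.inter ?_ (IsClosed.inter ?_ (IsClosed.inter ?_ (IsClosed.inter ?_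
      (IsClosed.inter ?_ (IsClosed.inter ?_ (IsClosed.inter ?_ ?_)))))) <;>
    exact isClosed_le (by fun_prop) (by fun_prop)
  · rintro ⟨w, γ, α, β⟩ ⟨h1, h2, h3, h4, h5, h6, h7, h8⟩
    simp only [Set.mem_prod, Set.mem_Icc] at *
    refine ⟨⟨?_, ?_⟩, ⟨?_, ?_⟩, ⟨?_, ?_⟩, ?_, ?_⟩ <;> linarith

lemma continuousOn_phi {q : ℕ} (hq : 3 ≤ q) :
    ContinuousOn (fun p : ℝ × ℝ × ℝ × ℝ => phi q p.1 p.2.1 p.2.2.1 p.2.2.2)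
      admissibleSet := by
  have h : ContinuousOn (fun p : ℝ × ℝ × ℝ × ℝ =>
      (Real.negMulLog p.2.2.1 + p.2.2.1 * Real.log ((q : ℝ) - 1) +
        Real.negMulLog (1 - p.2.1 - p.2.2.1) - Real.negMulLog (1 - p.2.1)) / Real.log q +
      (Real.negMulLog (p.1 - p.2.2.1 - p.2.2.2) +
        (p.1 - p.2.2.1 - p.2.2.2) * Real.log ((q : ℝ) - 1) +
        Real.negMulLog (p.2.1 - p.2.2.2 - (p.1 - p.2.2.1 - p.2.2.2)) -
        Real.negMulLog (p.2.1 - p.2.2.2)) / Real.log q +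
      (Real.negMulLog p.2.2.2 + p.2.2.2 * Real.log ((q : ℝ) - 1) +
        Real.negMulLog (p.2.1 - p.2.2.2) - Real.negMulLog p.2.1) / Real.log q +
      (p.1 - p.2.2.1) * Real.logb q (((q : ℝ) - 2) / ((q : ℝ) - 1)) -
      p.2.2.2 * Real.logb q ((q : ℝ) - 2)) admissibleSet :=
    Continuous.continuousOn (by fun_prop)
  refine h.congr ?_
  rintro ⟨w, γ, α, β⟩ ⟨h1, h2, h3, h4, h5, h6, h7, h8⟩
  simp only at h1 h2 h3 h4 h5 h6 h7 h8
  simp only [phi]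
  rw [mul_qEntropy_div hq h3 h5, mul_qEntropy_div hq (by linarith) (by linarith),
    mul_qEntropy_div hq h4 h6]

lemma exists_phi_le {q : ℕ} (hq : 3 ≤ q) :
    ∃ C, ∀ w γ α β, AdmissibleParams w γ α β → phi q w γ α β ≤ C := by
  obtain ⟨C, hC⟩ := isCompact_admissibleSet.bddAbove_image (continuousOn_phi hq)
  exact ⟨C, fun w γ α β h => hC ⟨(w, γ, α, β), h, rfl⟩⟩

lemma phi_le_f1 {q : ℕ} (hq : 3 ≤ q) {ω γ α β : ℝ} (h : AdmissibleParams ω γ α β)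
    (h1 : ω ^ 2 ≤ γ) (h2 : γ ≤ 1 - (1 - ω) ^ 2) (h3 : γ - β + α ≤ delta1 q ω) :
    phi q ω γ α β ≤ f1 q ω := by
  obtain ⟨C, hC⟩ := exists_phi_le hq
  refine le_csSup ⟨C, ?_⟩ ⟨γ, α, β, h, h1, h2, h3, rfl⟩
  rintro v ⟨γ, α, β, h, -, -, -, rfl⟩
  exact hC _ _ _ _ h

lemma phi_le_f2 {q : ℕ} (hq : 3 ≤ q) {ω γ α β : ℝ} (h : AdmissibleParams ω γ α β)
    (h1 : ω * ((q : ℝ) - 1) / q ≤ γ) (h2 : γ ≤ 1 - (1 - ω) / q)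
    (h3 : γ - β + α ≤ delta2 q ω) :
    phi q ω γ α β ≤ f2 q ω := by
  obtain ⟨C, hC⟩ := exists_phi_le hq
  refine le_csSup ⟨C, ?_⟩ ⟨γ, α, β, h, h1, h2, h3, rfl⟩
  rintro v ⟨γ, α, β, h, -, -, -, rfl⟩
  exact hC _ _ _ _ h

/-- An upper bound for `φ` on a constrained admissible region is stable under small
relaxations of the constraints. -/
lemma exists_slack_phi_le {q : ℕ} (hq : 3 ≤ q) {ω lo hi D f η : ℝ} (hη : 0 < η)
    (hf : ∀ γ α β, AdmissibleParams ω γ α β → lo ≤ γ → γ ≤ hi → γ - β + α ≤ D →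
      phi q ω γ α β ≤ f) :
    ∃ s₀ > 0, ∀ s < s₀, ∀ w γ α β, AdmissibleParams w γ α β → |w - ω| ≤ s → lo - s ≤ γ →
      γ ≤ hi + s → γ - β + α ≤ D + s → phi q w γ α β ≤ f + η := by
  let F : Set (ℝ × ℝ × ℝ × ℝ) := admissibleSet ∩
    (fun p : ℝ × ℝ × ℝ × ℝ => phi q p.1 p.2.1 p.2.2.1 p.2.2.2) ⁻¹' Set.Ici (f + η)
  have hF : IsCompact F :=
    isCompact_admissibleSet.of_isClosed_subset
      ((continuousOn_phi hq).preimage_isClosed_of_isClosed isCompact_admissibleSet.isClosed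
        isClosed_Ici) Set.inter_subset_left
  let g : ℝ × ℝ × ℝ × ℝ → ℝ := fun p =>
    max (max |p.1 - ω| (lo - p.2.1)) (max (p.2.1 - hi) (p.2.1 - p.2.2.2 + p.2.2.1 - D))
  have hg : Continuous g := by fun_prop
  have hpos : ∀ p ∈ F, 0 < g p := by
    rintro ⟨w, γ, α, β⟩ ⟨hadm, hge⟩
    by_contra hle
    simp only [g, not_lt, max_le_iff, sub_nonpos] at hle
    obtain ⟨⟨h1, h2⟩, h3, h4⟩ := hle
    obtain rfl : w = ω := sub_eq_zero.1 (abs_nonpos_iff.1 h1)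
    have := hf γ α β hadm h2 h3 h4
    simp only [Set.mem_preimage, Set.mem_Ici] at hge
    linarith
  rcases F.eq_empty_or_nonempty with hE | hne
  · refine ⟨1, one_pos, fun s _ w γ α β hadm _ _ _ _ => ?_⟩
    by_contra hcon
    have : (w, γ, α, β) ∈ F := ⟨hadm, (not_le.1 hcon).le⟩
    simp [hE] at this
  · obtain ⟨p, hp, hmin⟩ := hF.exists_isMinOn hne hg.continuousOn
    refine ⟨g p, hpos p hp, fun s hs w γ α β hadm h1 h2 h3 h4 => ?_⟩
    by_contra hcon
    have hle : g p ≤ g (w, γ, α, β) := hmin ⟨hadm, (not_le.1 hcon).le⟩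
    have : g (w, γ, α, β) ≤ s := by
      simp only [g, max_le_iff]
      refine ⟨⟨h1, ?_⟩, ?_, ?_⟩ <;> linarith
    linarith

end Compactness

section KeySpace

variable {q n M₁ M₂ : ℕ} [NeZero q]

/-- The independent ingredients of a key: a center for every group and a noise word for
every user. -/
abbrev KeyIndex (M₁ M₂ : ℕ) := Fin M₁ ⊕ (Fin M₁ × Fin M₂)

/-- The distribution of one symbol of an ingredient of the key: uniform for the centers. -/
noncomputable def symbolWeight (q : ℕ) [NeZero q] (ω : ℝ) :
    KeyIndex M₁ M₂ → Fin q → ℝ :=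
  Sum.elim (fun _ _ => 1 / (q : ℝ)) (fun _ => noise q ω)

/-- The distribution of an ingredient of the key, with i.i.d. symbols. -/
noncomputable def wordWeight (ω : ℝ) (s : KeyIndex M₁ M₂) (a : Fin n → Fin q) : ℝ :=
  ∏ l, symbolWeight q ω s (a l)

/-- The fingerprint of user `u` in the code with key `k`. -/
def fingerprint {G : Type*} [Add G] (k : KeyIndex M₁ M₂ → G) (u : Fin M₁ × Fin M₂) : G :=
  k (Sum.inl u.1) + k (Sum.inr u)

lemma symbolWeight_nonneg (hq : 3 ≤ q) {ω : ℝ} (h0 : 0 ≤ ω) (h1 : ω ≤ 1)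
    (s : KeyIndex M₁ M₂) (a : Fin q) : 0 ≤ symbolWeight q ω s a := by
  cases s with
  | inl i => simp [symbolWeight]
  | inr u => exact noise_nonneg hq h0 h1 a

lemma sum_uniform (q : ℕ) [NeZero q] : ∑ _a : Fin q, 1 / (q : ℝ) = 1 := by
  have : (q : ℝ) ≠ 0 := Nat.cast_ne_zero.2 (NeZero.ne q)
  simp [this]

lemma sum_symbolWeight (hq : 3 ≤ q) (ω : ℝ) (s : KeyIndex M₁ M₂) :
    ∑ a, symbolWeight q ω s a = 1 := by
  cases s with
  | inl i => exact sum_uniform q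
  | inr u => exact sum_noise hq ω

lemma wordWeight_nonneg (hq : 3 ≤ q) {ω : ℝ} (h0 : 0 ≤ ω) (h1 : ω ≤ 1)
    (s : KeyIndex M₁ M₂) (a : Fin n → Fin q) : 0 ≤ wordWeight ω s a :=
  Finset.prod_nonneg fun _ _ => symbolWeight_nonneg hq h0 h1 _ _

lemma sum_wordWeight (hq : 3 ≤ q) (ω : ℝ) (s : KeyIndex M₁ M₂) :
    ∑ a : Fin n → Fin q, wordWeight ω s a = 1 :=
  sum_prod_weights fun _ => sum_symbolWeight hq ω s

/-- The number of coordinates at which a column event of probability at least `m` occurs is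
rarely below `n (m - s)`. -/
lemma prodP_wordWeight_card_lt_le (hq : 3 ≤ q) (hn : 0 < n) {ω : ℝ} (h0 : 0 ≤ ω)
    (h1 : ω ≤ 1) (A : (KeyIndex M₁ M₂ → Fin q) → Prop) [DecidablePred A] {m s : ℝ}
    (hs : 0 < s) (hm : m ≤ prodP (symbolWeight q ω) A) :
    prodP (wordWeight ω) (fun k : KeyIndex M₁ M₂ → Fin n → Fin q =>
      ((Finset.univ.filter fun l => A (fun j => k j l)).card : ℝ) < n * (m - s)) ≤
        1 / (n * s ^ 2) := by
  classical
  have hP0 : ∀ c : KeyIndex M₁ M₂ → Fin q, 0 ≤ ∏ j, symbolWeight q ω j (c j) := fun c =>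
    Finset.prod_nonneg fun _ _ => symbolWeight_nonneg hq h0 h1 _ _
  have hP1 : ∑ c : KeyIndex M₁ M₂ → Fin q, ∏ j, symbolWeight q ω j (c j) = 1 :=
    sum_prod_weights (sum_symbolWeight hq ω)
  refine le_of_eq_of_le ?_ (prodP_card_lt_le hn hP0 hP1 A hs (m := m) ?_)
  · simp only [prodP, prodE, wordWeight]
    refine Fintype.sum_equiv (Equiv.piComm _) _ _ fun k => ?_
    simp only [Equiv.piComm_apply]
    rw [Finset.prod_comm]
    congr
  · refine hm.trans_eq ?_
    simp only [prodP, prodE]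
    refine Finset.sum_congr rfl fun c _ => ?_
    congr

lemma prodE_sumElim {ι κ Ω : Type*} [Fintype ι] [Fintype κ] [DecidableEq ι] [DecidableEq κ]
    [Fintype Ω] (p : ι → Ω → ℝ) (r : κ → Ω → ℝ) (F : (ι ⊕ κ → Ω) → ℝ) :
    prodE (Sum.elim p r) F = prodE p (fun c => prodE r (fun z => F (Sum.elim c z))) := by
  simp only [prodE]
  rw [← (Equiv.sumArrowEquivProdArrow ι κ Ω).symm.sum_comp, Fintype.sum_prod_type]
  refine Finset.sum_congr rfl fun c _ => ?_
  rw [Finset.mul_sum]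
  refine Finset.sum_congr rfl fun z _ => ?_
  rw [Fintype.prod_sum_type]
  simp [Equiv.sumArrowEquivProdArrow, mul_assoc]

lemma prodE_fingerprints_eq_ge (hq : 3 ≤ q) {ω : ℝ} (h0 : 0 ≤ ω) (h1 : ω ≤ 1) {m : ℕ}
    (u : Fin m → Fin M₁ × Fin M₂) (hu : Function.Injective u) (a : Fin q) :
    (1 / (q : ℝ)) ^ m ≤ prodE (symbolWeight q ω)
      (fun c => ∏ i, if fingerprint c (u i) = a then 1 else 0) := by
  classical
  rw [symbolWeight, prodE_sumElim]
  set S := Finset.univ.image u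
  have hinner : ∀ c : Fin M₁ → Fin q,
      prodE (fun _ : Fin M₁ × Fin M₂ => noise q ω) (fun z =>
        ∏ i, if fingerprint (Sum.elim c z) (u i) = a then 1 else 0) =
      ∏ g, noise q ω (a - c g) ^ (S.filter fun v => v.1 = g).card := by
    intro c
    have e1 : ∀ z : Fin M₁ × Fin M₂ → Fin q,
        (∏ i, if fingerprint (Sum.elim c z) (u i) = a then (1 : ℝ) else 0) =
        ∏ v, (fun v b => if v ∈ S then (if c v.1 + b = a then (1 : ℝ) else 0) else 1) v
          (z v) := by
      intro z
      simp only [Finset.prod_ite_mem, Finset.univ_inter]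
      rw [Finset.prod_image fun x _ y _ h => hu h]
      refine Finset.prod_congr rfl fun i _ => ?_
      congr
    simp only [e1]
    rw [prodE_prod (fun _ => noise q ω)
      (fun v b => if v ∈ S then (if c v.1 + b = a then (1 : ℝ) else 0) else 1)]
    have e2 : ∀ v : Fin M₁ × Fin M₂, ∑ b, noise q ω b *
        (if v ∈ S then (if c v.1 + b = a then (1 : ℝ) else 0) else 1) =
        if v ∈ S then noise q ω (a - c v.1) else 1 := by
      intro v
      split_ifs with hv
      · simp only [← eq_sub_iff_add_eq', mul_ite, mul_one, mul_zero, Finset.sum_ite_eq',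
          Finset.mem_univ, if_true]
      · simp [sum_noise hq]
    simp only [e2, Finset.prod_ite_mem, Finset.univ_inter]
    rw [← Finset.prod_fiberwise S (fun v => v.1)]
    refine Finset.prod_congr rfl fun g _ => ?_
    rw [← Finset.prod_const]
    refine Finset.prod_congr rfl fun v hv => ?_
    rw [(Finset.mem_filter.1 hv).2]
  simp only [hinner]
  rw [prodE_prod (fun _ _ => 1 / (q : ℝ))
    (fun g b => noise q ω (a - b) ^ (S.filter fun v => v.1 = g).card)]
  have hcard : ∑ g, (S.filter fun v => v.1 = g).card = m := by
    rw [← Finset.card_eq_sum_card_fiberwise (fun v _ => Finset.mem_univ v.1)]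
    rw [Finset.card_image_of_injective _ hu, Finset.card_univ, Fintype.card_fin]
  calc (1 / (q : ℝ)) ^ m
      = ∏ g, (1 / (q : ℝ)) ^ (S.filter fun v => v.1 = g).card := by
        rw [Finset.prod_pow_eq_pow_sum, hcard]
    _ ≤ _ := by
        refine Finset.prod_le_prod (fun g _ => by positivity) fun g _ => ?_
        have hJ := Real.pow_arith_mean_le_arith_mean_pow Finset.univ
          (fun _ : Fin q => 1 / (q : ℝ)) (fun b => noise q ω (a - b))
          (fun _ _ => by positivity) (sum_uniform q) (fun b _ => noise_nonneg hq h0 h1 _)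
          (S.filter fun v => v.1 = g).card
        have hsum : ∑ b, noise q ω (a - b) = 1 :=
          ((Equiv.subLeft a).sum_comp (noise q ω)).trans (sum_noise hq ω)
        rwa [← Finset.mul_sum, hsum, mul_one] at hJ

/-- The fingerprints of a coalition of size `m` agree at a given coordinate with probability
at least `q ^ (1 - m)`, however its members are distributed among the groups. -/
lemma prodP_all_eq_ge (hq : 3 ≤ q) {ω : ℝ} (h0 : 0 ≤ ω) (h1 : ω ≤ 1) {m : ℕ} (hm : 0 < m)
    (u : Fin m → Fin M₁ × Fin M₂) (hu : Function.Injective u) :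
    1 / (q : ℝ) ^ (m - 1) ≤ prodP (symbolWeight q ω)
      (fun c => ∃ a, ∀ i, fingerprint c (u i) = a) := by
  classical
  have hq0 : (q : ℝ) ≠ 0 := Nat.cast_ne_zero.2 (NeZero.ne q)
  have hind : ∀ c : KeyIndex M₁ M₂ → Fin q,
      (if ∃ a, ∀ i, fingerprint c (u i) = a then (1 : ℝ) else 0) =
        ∑ a, ∏ i, if fingerprint c (u i) = a then 1 else 0 := by
    intro c
    have : ∀ a, (∏ i, if fingerprint c (u i) = a then (1 : ℝ) else 0) =
        if ∀ i, fingerprint c (u i) = a then 1 else 0 := by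
      intro a
      rw [Finset.prod_ite_zero]
      simp
    simp only [this]
    split_ifs with h
    · obtain ⟨a, ha⟩ := h
      have : ∀ b, (∀ i, fingerprint c (u i) = b) ↔ b = a := fun b =>
        ⟨fun hb => (hb ⟨0, hm⟩).symm.trans (ha ⟨0, hm⟩), fun hb => hb ▸ ha⟩
      simp [this]
    · symm
      exact Finset.sum_eq_zero fun a _ => if_neg fun ha => h ⟨a, ha⟩
  have : prodP (symbolWeight q ω) (fun c => ∃ a, ∀ i, fingerprint c (u i) = a) =
      ∑ a, prodE (symbolWeight q ω)
        (fun c => ∏ i, if fingerprint c (u i) = a then 1 else 0) := by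
    rw [← prodE_sum]
    simp only [← hind, prodP]
    congr!
  rw [this]
  calc 1 / (q : ℝ) ^ (m - 1) = ∑ _a : Fin q, (1 / (q : ℝ)) ^ m := by
        obtain ⟨m, rfl⟩ : ∃ m', m = m' + 1 := ⟨m - 1, by omega⟩
        simp only [Finset.sum_const, Finset.card_univ, Fintype.card_fin, nsmul_eq_mul,
          Nat.add_sub_cancel, div_pow, one_pow, pow_succ]
        field_simp
    _ ≤ _ := Finset.sum_le_sum fun a _ => prodE_fingerprints_eq_ge hq h0 h1 u hu a

lemma sum_noise_mul_ite_zero (ω : ℝ) :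
    ∑ a, noise q ω a * (if a = 0 then 1 else 0) = 1 - ω := by
  simp [noise]

lemma sum_noise_mul_ite_ne_zero (hq : 3 ≤ q) (ω : ℝ) :
    ∑ a, noise q ω a * (if a ≠ 0 then 1 else 0) = ω := by
  have h1 := sum_noise hq ω
  have h2 := sum_noise_mul_ite_zero (q := q) ω
  have h3 : ∑ a, noise q ω a * (if a ≠ 0 then 1 else 0) +
      ∑ a, noise q ω a * (if a = 0 then 1 else 0) = ∑ a, noise q ω a := by
    rw [← Finset.sum_add_distrib]
    exact Finset.sum_congr rfl fun a _ => by by_cases h : a = 0 <;> simp [h]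
  linarith

lemma prodP_noise_and (hq : 3 ≤ q) {ω : ℝ} {u v : Fin M₁ × Fin M₂} (huv : u ≠ v)
    (A B : Fin q → Prop) [DecidablePred A] [DecidablePred B] :
    prodP (symbolWeight q ω) (fun c => A (c (Sum.inr u)) ∧ B (c (Sum.inr v))) =
      (∑ a, noise q ω a * (if A a then 1 else 0)) *
        ∑ a, noise q ω a * (if B a then 1 else 0) := by
  classical
  rw [prodP, prodE_resample (sum_symbolWeight hq ω) (Sum.inr u)]
  refine prodE_resample_const (sum_symbolWeight hq ω) (Sum.inr v) fun k => ?_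
  have hne : (Sum.inr v : KeyIndex M₁ M₂) ≠ Sum.inr u := fun h => huv (Sum.inr.inj h).symm
  simp only [Function.update_self, Function.update_of_ne hne, symbolWeight, Sum.elim_inr]
  rw [Finset.sum_mul_sum, Finset.sum_comm]
  simp only [Finset.mul_sum]
  refine Finset.sum_congr rfl fun a _ => Finset.sum_congr rfl fun b _ => ?_
  by_cases hA : A b <;> by_cases hB : B a <;> simp [hA, hB, mul_comm]

lemma prodP_noise (hq : 3 ≤ q) {ω : ℝ} (u : Fin M₁ × Fin M₂)
    (A : Fin q → Prop) [DecidablePred A] :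
    prodP (symbolWeight q ω) (fun c => A (c (Sum.inr u))) =
      ∑ a, noise q ω a * (if A a then 1 else 0) := by
  refine prodE_resample_const (sum_symbolWeight hq ω) (Sum.inr u) fun k => ?_
  simp only [Function.update_self, symbolWeight, Sum.elim_inr]

lemma prodP_noise_eq (hq : 3 ≤ q) {ω : ℝ} {u v : Fin M₁ × Fin M₂} (huv : u ≠ v) :
    prodP (symbolWeight q ω) (fun c => c (Sum.inr u) = c (Sum.inr v)) =
      (1 - ω) ^ 2 + ω ^ 2 / ((q : ℝ) - 1) := by
  classical
  rw [prodP, prodE_resample (sum_symbolWeight hq ω) (Sum.inr u)]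
  refine prodE_resample_const (sum_symbolWeight hq ω) (Sum.inr v) fun k => ?_
  have hq' : (3 : ℝ) ≤ q := by exact_mod_cast hq
  have hq1 : (q : ℝ) - 1 ≠ 0 := by linarith
  have hne : (Sum.inr v : KeyIndex M₁ M₂) ≠ Sum.inr u := fun h => huv (Sum.inr.inj h).symm
  simp only [Function.update_self, Function.update_of_ne hne, symbolWeight, Sum.elim_inr,
    mul_ite, mul_one, mul_zero, Finset.sum_ite_eq', Finset.mem_univ, if_true]
  have : ∀ a, noise q ω a * noise q ω a =
      if a = 0 then (1 - ω) * (1 - ω) else ω / ((q : ℝ) - 1) * (ω / ((q : ℝ) - 1)) := by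
    intro a; unfold noise; split_ifs <;> rfl
  simp only [this]
  rw [sum_ite_eq_const]
  field_simp

/-- For users of different groups, the noise of `u` is independent of the uniformly
distributed difference between the fingerprint of `v` and the center of the group of `u`. -/
lemma prodP_noise_and_fingerprint (hq : 3 ≤ q) {ω : ℝ} {u v : Fin M₁ × Fin M₂}
    (huv : u.1 ≠ v.1) (A B : Fin q → Prop) [DecidablePred A] [DecidablePred B] :
    prodP (symbolWeight q ω)
      (fun c => A (c (Sum.inr u)) ∧ B (fingerprint c v - c (Sum.inl u.1))) =
      (∑ a, noise q ω a * (if A a then 1 else 0)) *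
        ∑ a : Fin q, 1 / (q : ℝ) * (if B a then 1 else 0) := by
  classical
  rw [prodP, prodE_resample (sum_symbolWeight hq ω) (Sum.inl v.1)]
  refine prodE_resample_const (sum_symbolWeight hq ω) (Sum.inr u) fun k => ?_
  have hne : (Sum.inl u.1 : KeyIndex M₁ M₂) ≠ Sum.inl v.1 := fun h => huv (Sum.inl.inj h)
  have hne' : (Sum.inr v : KeyIndex M₁ M₂) ≠ Sum.inr u := fun h => huv (by
    rw [Sum.inr.inj h])
  simp only [fingerprint, Function.update_self, Function.update_of_ne hne, ne_eq, reduceCtorEq,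
    not_false_eq_true, Function.update_of_ne, Function.update_of_ne hne', symbolWeight,
    Sum.elim_inr, Sum.elim_inl]
  rw [Finset.sum_mul]
  refine Finset.sum_congr rfl fun a _ => ?_
  rw [mul_assoc]
  congr 1
  rw [← Equiv.sum_comp (Equiv.addRight (k (Sum.inr v) - k (Sum.inl u.1)))
    (fun b => 1 / (q : ℝ) * (if B b then 1 else 0)), Finset.mul_sum]
  refine Finset.sum_congr rfl fun b _ => ?_
  simp only [Equiv.coe_addRight, add_sub_assoc]
  by_cases hA : A a <;> by_cases hB : B (b + (k (Sum.inr v) - k (Sum.inl u.1))) <;>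
    simp [hA, hB]

end KeySpace

section Typicality

variable {q n M₁ M₂ m : ℕ}

open scoped Classical in
/-- The number of columns of the key `k` at which the event `A` occurs. -/
noncomputable def columnCount (A : (KeyIndex M₁ M₂ → Fin q) → Prop)
    (k : KeyIndex M₁ M₂ → Fin n → Fin q) : ℕ :=
  (Finset.univ.filter fun l => A (fun j => k j l)).card

lemma columnCount_update (A : (KeyIndex M₁ M₂ → Fin q) → Prop) (s : KeyIndex M₁ M₂)
    (hA : ∀ c a, A (Function.update c s a) ↔ A c) (k : KeyIndex M₁ M₂ → Fin n → Fin q)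
    (a : Fin n → Fin q) : columnCount A (Function.update k s a) = columnCount A k := by
  classical
  unfold columnCount
  congr 1
  ext l
  have : (fun j => Function.update k s a j l) = Function.update (fun j => k j l) s (a l) := by
    funext j
    by_cases h : j = s
    · subst h; simp
    · simp [h]
  simp only [Finset.mem_filter, Finset.mem_univ, true_and, this, hA]

/-- A word of the envelope is close to one of the fingerprints that generate it. -/
lemma exists_hammingDist_le (hm : 0 < m) (x : Fin m → Fin n → Fin q) {y : Fin n → Fin q}
    (hy : InEnvelope x y) [DecidablePred fun l => ∃ a, ∀ i, x i l = a] :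
    ∃ i, (hammingDist (x i) y : ℝ) ≤ ((m : ℝ) - 1) / m *
      (n - (Finset.univ.filter fun l => ∃ a, ∀ i, x i l = a).card) := by
  have hm' : (0 : ℝ) < m := by exact_mod_cast hm
  have : Nonempty (Fin m) := ⟨⟨0, hm⟩⟩
  by_contra! hcon
  have hlt := Finset.sum_lt_sum_of_nonempty (Finset.univ_nonempty (α := Fin m))
    fun i _ => hcon i
  rw [Finset.sum_const, Finset.card_univ, Fintype.card_fin, nsmul_eq_mul, ← mul_assoc,
    mul_div_cancel₀ _ hm'.ne'] at hlt
  have hsum : ∑ i, (hammingDist (x i) y : ℝ) =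
      ∑ l, ((Finset.univ.filter fun i => x i l ≠ y l).card : ℝ) := by
    simp only [hammingDist, Finset.card_filter]
    push_cast
    exact Finset.sum_comm
  have hle : ∀ l, ((Finset.univ.filter fun i => x i l ≠ y l).card : ℝ) ≤
      if ∃ a, ∀ i, x i l = a then 0 else (m : ℝ) - 1 := by
    intro l
    obtain ⟨j, hj⟩ := hy l
    split_ifs with h
    · obtain ⟨a, ha⟩ := h
      have : (Finset.univ.filter fun i => x i l ≠ y l) = ∅ := by
        refine Finset.filter_eq_empty_iff.2 fun i _ => ?_
        simp [hj, ha]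
      simp [this]
    · have hss : (Finset.univ.filter fun i => x i l ≠ y l) ⊆ Finset.univ.erase j := by
        intro i hi
        rw [Finset.mem_erase]
        refine ⟨?_, Finset.mem_univ _⟩
        rintro rfl
        exact (Finset.mem_filter.1 hi).2 hj.symm
      have := Finset.card_le_card hss
      rw [Finset.card_erase_of_mem (Finset.mem_univ _), Finset.card_univ,
        Fintype.card_fin] at this
      rw [← Nat.cast_one, ← Nat.cast_sub hm]
      exact_mod_cast this
  have hc := Finset.card_filter_add_card_filter_not (s := (Finset.univ : Finset (Fin n)))
    (fun l => ∃ a, ∀ i, x i l = a)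
  rw [Finset.card_univ, Fintype.card_fin] at hc
  have hc' : ((Finset.univ.filter fun l => ∃ a, ∀ i, x i l = a).card : ℝ) +
      (Finset.univ.filter fun l => ¬ ∃ a, ∀ i, x i l = a).card = n := by exact_mod_cast hc
  have htot := Finset.sum_le_sum fun l (_ : l ∈ Finset.univ) => hle l
  rw [Finset.sum_ite, Finset.sum_const_zero, zero_add, Finset.sum_const, nsmul_eq_mul,
    ← hsum] at htot
  have : ((Finset.univ.filter fun l => ¬ ∃ a, ∀ i, x i l = a).card : ℝ) =
      n - (Finset.univ.filter fun l => ∃ a, ∀ i, x i l = a).card := by linarith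
  rw [this] at htot
  linarith

variable [NeZero q]

/-- The empirical frequencies of the events relevant to the coalition `u` are, up to `s`, at
least their expectations. -/
def IsTypicalKey (ω s pe lo hi : ℝ) (u : Fin m → Fin M₁ × Fin M₂)
    (k : KeyIndex M₁ M₂ → Fin n → Fin q) : Prop :=
  (n : ℝ) * (pe - s) ≤ columnCount (fun c => ∃ a, ∀ i, fingerprint c (u i) = a) k ∧
  (∀ i, (n : ℝ) * (ω - s) ≤ columnCount (fun c => c (Sum.inr (u i)) ≠ 0) k) ∧
  (∀ i, (n : ℝ) * (1 - ω - s) ≤ columnCount (fun c => c (Sum.inr (u i)) = 0) k) ∧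
  (∀ i, (n : ℝ) * (lo - s) ≤
    columnCount (fun c => ∀ j, fingerprint c (u j) ≠ c (Sum.inl (u i).1)) k) ∧
  (∀ i, (n : ℝ) * (1 - hi - s) ≤
    columnCount (fun c => ∀ j, fingerprint c (u j) = c (Sum.inl (u i).1)) k)

lemma isTypicalKey_update (ω s pe lo hi : ℝ) (u : Fin m → Fin M₁ × Fin M₂)
    (w : Fin M₁ × Fin M₂) (hw : ∀ i, w ≠ u i) (k : KeyIndex M₁ M₂ → Fin n → Fin q)
    (a : Fin n → Fin q) :
    IsTypicalKey ω s pe lo hi u (Function.update k (Sum.inr w) a) ↔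
      IsTypicalKey ω s pe lo hi u k := by
  have h1 : ∀ i, (Sum.inr (u i) : KeyIndex M₁ M₂) ≠ Sum.inr w :=
    fun i h => hw i (Sum.inr.inj h).symm
  have h2 : ∀ i, (Sum.inl i : KeyIndex M₁ M₂) ≠ Sum.inr w := fun i h => by cases h
  have hA : ∀ (c : KeyIndex M₁ M₂ → Fin q) b i,
      fingerprint (Function.update c (Sum.inr w) b) (u i) = fingerprint c (u i) := by
    intro c b i
    simp only [fingerprint, Function.update_of_ne (h1 i), Function.update_of_ne (h2 _)]
  unfold IsTypicalKey
  rw [columnCount_update]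
  · refine and_congr Iff.rfl (and_congr ?_ (and_congr ?_ (and_congr ?_ ?_))) <;>
    · refine forall_congr' fun i => ?_
      rw [columnCount_update]
      intro c b
      simp only [hA, Function.update_of_ne (h1 i), Function.update_of_ne (h2 _)]
  · intro c b
    simp only [hA]

lemma prodP_columnCount_lt_le (hq : 3 ≤ q) (hn : 0 < n) {ω : ℝ} (h0 : 0 ≤ ω)
    (h1 : ω ≤ 1) (A : (KeyIndex M₁ M₂ → Fin q) → Prop) {p s : ℝ}
    (hs : 0 < s) (hp : p ≤ prodP (symbolWeight q ω) A) :
    prodP (wordWeight ω) (fun k : KeyIndex M₁ M₂ → Fin n → Fin q =>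
      ¬ (n : ℝ) * (p - s) ≤ columnCount A k) ≤ 1 / (n * s ^ 2) := by
  classical
  have hc : ∀ k : KeyIndex M₁ M₂ → Fin n → Fin q,
      columnCount A k = (Finset.univ.filter fun l => A (fun j => k j l)).card := fun k => by
    unfold columnCount; congr!
  simp only [not_le, hc]
  exact prodP_wordWeight_card_lt_le hq hn h0 h1 A hs hp

lemma prodP_not_isTypicalKey_le (hq : 3 ≤ q) (hn : 0 < n) {ω s pe lo hi : ℝ} (h0 : 0 ≤ ω)
    (h1 : ω ≤ 1) (hs : 0 < s) (u : Fin m → Fin M₁ × Fin M₂)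
    (hpe : pe ≤ prodP (symbolWeight q ω) fun c => ∃ a, ∀ i, fingerprint c (u i) = a)
    (hlo : ∀ i, lo ≤ prodP (symbolWeight q ω)
      fun c => ∀ j, fingerprint c (u j) ≠ c (Sum.inl (u i).1))
    (hhi : ∀ i, 1 - hi ≤ prodP (symbolWeight q ω)
      fun c => ∀ j, fingerprint c (u j) = c (Sum.inl (u i).1)) :
    prodP (wordWeight ω) (fun k : KeyIndex M₁ M₂ → Fin n → Fin q =>
      ¬ IsTypicalKey ω s pe lo hi u k) ≤ (1 + 4 * m) * (1 / (n * s ^ 2)) := by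
  have hw : ∀ (j : KeyIndex M₁ M₂) (a : Fin n → Fin q), 0 ≤ wordWeight ω j a :=
    wordWeight_nonneg hq h0 h1
  have hex : ∀ (p : ℝ) (A : Fin m → (KeyIndex M₁ M₂ → Fin q) → Prop),
      (∀ i, p ≤ prodP (symbolWeight q ω) (A i)) →
      prodP (wordWeight ω) (fun k : KeyIndex M₁ M₂ → Fin n → Fin q =>
        ¬ ∀ i, (n : ℝ) * (p - s) ≤ columnCount (A i) k) ≤ m * (1 / (n * s ^ 2)) := by
    intro p A hA
    simp only [not_forall]
    refine (prodP_exists_le hw _).trans ((Finset.sum_le_card_nsmul _ _ (1 / (n * s ^ 2))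
      fun i _ => prodP_columnCount_lt_le hq hn h0 h1 (A i) hs (hA i)).trans_eq ?_)
    simp
  have e1 := prodP_columnCount_lt_le (n := n) hq hn h0 h1 _ hs hpe
  have e2 := hex ω (fun i c => c (Sum.inr (u i)) ≠ 0) fun i => by
    rw [prodP_noise hq (u i) (fun a => a ≠ 0), sum_noise_mul_ite_ne_zero hq]
  have e3 := hex (1 - ω) (fun i c => c (Sum.inr (u i)) = 0) fun i => by
    rw [prodP_noise hq (u i) (fun a => a = 0), sum_noise_mul_ite_zero]
  have e4 := hex lo _ hlo
  have e5 := hex (1 - hi) _ hhi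
  simp only [IsTypicalKey, not_and_or]
  refine (prodP_or_le hw _ _).trans ?_
  refine (add_le_add e1 ((prodP_or_le hw _ _).trans (add_le_add e2 ((prodP_or_le hw _ _).trans
    (add_le_add e3 ((prodP_or_le hw _ _).trans (add_le_add e4 e5))))))).trans_eq ?_
  ring

lemma IsTypicalKey.abs_hammingNorm_sub_le {ω s pe lo hi : ℝ} {u : Fin m → Fin M₁ × Fin M₂}
    {k : KeyIndex M₁ M₂ → Fin n → Fin q} (h : IsTypicalKey ω s pe lo hi u k) (i : Fin m) :
    |(hammingNorm (k (Sum.inr (u i))) : ℝ) - ω * n| ≤ s * n := by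
  classical
  have h2 := h.2.1 i
  have h3 := h.2.2.1 i
  have hc := card_zero_add_hammingNorm (k (Sum.inr (u i)))
  have e2 : columnCount (fun c => c (Sum.inr (u i)) ≠ 0) k =
      hammingNorm (k (Sum.inr (u i))) := by
    unfold columnCount hammingNorm; congr!
  have e3 : columnCount (fun c => c (Sum.inr (u i)) = 0) k =
      (Finset.univ.filter fun l => k (Sum.inr (u i)) l = 0).card := by
    unfold columnCount; congr!
  rw [e2] at h2
  rw [e3] at h3
  have hc' : ((Finset.univ.filter fun l => k (Sum.inr (u i)) l = 0).card : ℝ) +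
      hammingNorm (k (Sum.inr (u i))) = n := by exact_mod_cast hc
  rw [abs_le]
  constructor <;> linarith

lemma IsTypicalKey.hammingDist_center {ω s pe lo hi : ℝ} {u : Fin m → Fin M₁ × Fin M₂}
    {k : KeyIndex M₁ M₂ → Fin n → Fin q} (h : IsTypicalKey ω s pe lo hi u k)
    {y : Fin n → Fin q} (hy : InEnvelope (fun i => fingerprint k (u i)) y) (i : Fin m) :
    (n : ℝ) * (lo - s) ≤ hammingDist y (k (Sum.inl (u i).1)) ∧
      (hammingDist y (k (Sum.inl (u i).1)) : ℝ) ≤ n * (hi + s) := by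
  classical
  have h4 := h.2.2.2.1 i
  have h5 := h.2.2.2.2 i
  constructor
  · refine h4.trans ?_
    unfold columnCount hammingDist
    refine Nat.cast_le.2 (Finset.card_le_card fun l hl => ?_)
    simp only [Finset.mem_filter, Finset.mem_univ, true_and] at hl ⊢
    obtain ⟨j, hj⟩ := hy l
    rw [hj]
    exact hl j
  · have hc := Finset.card_filter_add_card_filter_not (s := (Finset.univ : Finset (Fin n)))
      (fun l => y l = k (Sum.inl (u i).1) l)
    rw [Finset.card_univ, Fintype.card_fin] at hc
    have hd : (Finset.univ.filter fun l => ¬ y l = k (Sum.inl (u i).1) l).card =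
        hammingDist y (k (Sum.inl (u i).1)) := by
      unfold hammingDist; congr!
    have hle : columnCount (fun c => ∀ j, fingerprint c (u j) = c (Sum.inl (u i).1)) k ≤
        (Finset.univ.filter fun l => y l = k (Sum.inl (u i).1) l).card := by
      unfold columnCount
      refine Finset.card_le_card fun l hl => ?_
      simp only [Finset.mem_filter, Finset.mem_univ, true_and] at hl ⊢
      obtain ⟨j, hj⟩ := hy l
      rw [hj]
      exact hl j
    rw [hd] at hc
    have hc' : ((Finset.univ.filter fun l => y l = k (Sum.inl (u i).1) l).card : ℝ) +
      hammingDist y (k (Sum.inl (u i).1)) = n := by exact_mod_cast hc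
    have hle' := (Nat.cast_le (α := ℝ)).2 hle
    linarith

lemma IsTypicalKey.exists_hammingDist_le {ω s pe lo hi D : ℝ} {u : Fin m → Fin M₁ × Fin M₂}
    {k : KeyIndex M₁ M₂ → Fin n → Fin q} (h : IsTypicalKey ω s pe lo hi u k) (hm : 0 < m)
    (hD : ((m : ℝ) - 1) / m * (1 - pe + s) ≤ D)
    {y : Fin n → Fin q} (hy : InEnvelope (fun i => fingerprint k (u i)) y) :
    ∃ i, (hammingDist (fingerprint k (u i)) y : ℝ) ≤ D * n := by
  classical
  obtain ⟨i, hi⟩ := _root_.exists_hammingDist_le hm _ hy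
  refine ⟨i, hi.trans ?_⟩
  have hJ : (n : ℝ) * (pe - s) ≤ ((Finset.univ.filter fun l =>
      ∃ a, ∀ i, fingerprint k (u i) l = a).card : ℝ) := by
    refine h.1.trans_eq ?_
    unfold columnCount
    congr!
  have hm1 : (1 : ℝ) ≤ m := by exact_mod_cast hm
  have hcoef : 0 ≤ ((m : ℝ) - 1) / m := div_nonneg (by linarith) (by linarith)
  calc _ ≤ ((m : ℝ) - 1) / m * (n - n * (pe - s)) :=
        mul_le_mul_of_nonneg_left (sub_le_sub_left hJ _) hcoef
    _ = ((m : ℝ) - 1) / m * (1 - pe + s) * n := by ring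
    _ ≤ D * n := mul_le_mul_of_nonneg_right hD (Nat.cast_nonneg n)

end Typicality

section Observation

variable {ι Ω Y : Type*} [Fintype ι] [DecidableEq ι] [Fintype Ω] [Fintype Y]

open scoped Classical in
/-- The probability of `B` when the key `k` is drawn according to the weights `p` and the
observation `y` is then drawn according to the weights `A k`. -/
noncomputable def obsP (p : ι → Ω → ℝ) (A : (ι → Ω) → Y → ℝ) (B : (ι → Ω) → Y → Prop) : ℝ :=
  prodE p fun k => ∑ y, A k y * if B k y then 1 else 0

lemma obsP_or_le {p : ι → Ω → ℝ} (hp : ∀ i a, 0 ≤ p i a) {A : (ι → Ω) → Y → ℝ}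
    (hA : ∀ k y, 0 ≤ A k y) (B C : (ι → Ω) → Y → Prop) :
    obsP p A (fun k y => B k y ∨ C k y) ≤ obsP p A B + obsP p A C := by
  rw [obsP, obsP, obsP, ← prodE_add]
  refine prodE_mono hp fun k => ?_
  rw [← Finset.sum_add_distrib]
  refine Finset.sum_le_sum fun y _ => ?_
  have := hA k y
  by_cases hB : B k y <;> by_cases hC : C k y <;> simp [hB, hC, this]

lemma obsP_exists_le {σ : Type*} [Fintype σ] {p : ι → Ω → ℝ} (hp : ∀ i a, 0 ≤ p i a)
    {A : (ι → Ω) → Y → ℝ} (hA : ∀ k y, 0 ≤ A k y) (B : σ → (ι → Ω) → Y → Prop) :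
    obsP p A (fun k y => ∃ j, B j k y) ≤ ∑ j, obsP p A (B j) := by
  classical
  simp only [obsP]
  rw [← prodE_sum]
  refine prodE_mono hp fun k => ?_
  rw [Finset.sum_comm]
  refine Finset.sum_le_sum fun y _ => ?_
  rw [← Finset.mul_sum]
  refine mul_le_mul_of_nonneg_left ?_ (hA k y)
  split_ifs with h
  · obtain ⟨j, hj⟩ := h
    refine le_trans (by simp [hj]) (Finset.single_le_sum
      (f := fun j => if B j k y then (1 : ℝ) else 0) (fun i _ => ?_) (Finset.mem_univ j))
    split_ifs <;> norm_num
  · exact Finset.sum_nonneg fun i _ => by split_ifs <;> norm_num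

open scoped Classical in
/-- A bound for a randomized observation `y`, whose conditional weights `A k y` do not depend
on the coordinate `s` of the key. -/
lemma obsP_le_of_resample_le {p : ι → Ω → ℝ} (hp0 : ∀ i a, 0 ≤ p i a)
    (hp : ∀ i, ∑ a, p i a = 1) (s : ι) (A : (ι → Ω) → Y → ℝ) (B : (ι → Ω) → Y → Prop)
    (hA : ∀ k a y, A (Function.update k s a) y = A k y) (hA0 : ∀ k y, 0 ≤ A k y)
    (hA1 : ∀ k, ∑ y, A k y ≤ 1) {b : ℝ} (hb : 0 ≤ b)
    (hB : ∀ k y, A k y ≠ 0 →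
      ∑ a, p s a * (if B (Function.update k s a) y then 1 else 0) ≤ b) :
    obsP p A B ≤ b := by
  rw [obsP, prodE_resample hp s]
  refine (prodE_mono hp0 (G := fun _ => b) fun k => ?_).trans_eq (prodE_const hp b)
  calc ∑ a, p s a * ∑ y, A (Function.update k s a) y *
        (if B (Function.update k s a) y then 1 else 0)
      = ∑ y, A k y * ∑ a, p s a * (if B (Function.update k s a) y then 1 else 0) := by
        simp only [hA, Finset.mul_sum]
        rw [Finset.sum_comm]
        exact Finset.sum_congr rfl fun y _ => Finset.sum_congr rfl fun a _ => by ring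
    _ ≤ ∑ y, A k y * b := by
        refine Finset.sum_le_sum fun y _ => ?_
        by_cases h : A k y = 0
        · simp [h]
        · exact mul_le_mul_of_nonneg_left (hB k y h) (hA0 k y)
    _ ≤ b := by
        rw [← Finset.sum_mul]
        exact mul_le_of_le_one_left hb (hA1 k)

/-- It suffices to bound the failures `B` that accompany typical keys. -/
lemma prodE_sum_filter_le {p : ι → Ω → ℝ} (hp : ∀ i a, 0 ≤ p i a) {A : (ι → Ω) → Y → ℝ}
    (hA : ∀ k y, 0 ≤ A k y) (hA1 : ∀ k, ∑ y, A k y = 1) (T : (ι → Ω) → Prop)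
    (F B : (ι → Ω) → Y → Prop) [∀ k, DecidablePred (F k)]
    (h : ∀ k y, T k → A k y ≠ 0 → F k y → B k y) :
    prodE p (fun k => ∑ y ∈ Finset.univ.filter (F k), A k y) ≤
      prodP p (fun k => ¬ T k) + obsP p A B := by
  classical
  rw [prodP, obsP, ← prodE_add]
  refine prodE_mono hp fun k => ?_
  have h0 : 0 ≤ ∑ y, A k y * (if B k y then 1 else 0) :=
    Finset.sum_nonneg fun y _ => mul_nonneg (hA k y) (by split_ifs <;> norm_num)
  by_cases hT : T k
  · simp only [hT, not_true_eq_false, if_false, zero_add]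
    rw [Finset.sum_filter]
    refine Finset.sum_le_sum fun y _ => ?_
    by_cases hy : A k y = 0
    · simp [hy]
    · by_cases hF : F k y
      · simp [hF, h k y hT hy hF]
      · simp only [hF, if_false]
        exact mul_nonneg (hA k y) (by split_ifs <;> norm_num)
  · simp only [hT, not_false_eq_true, if_true]
    have := Finset.sum_le_sum_of_subset_of_nonneg (Finset.filter_subset (F k) Finset.univ)
      fun y _ _ => hA k y
    linarith [hA1 k]

end Observation

section RandomCode

variable {q n M₁ M₂ m : ℕ} [NeZero q]

/-- The random code whose key is drawn according to the word weights. -/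
noncomputable def randCodeOf (hq : 3 ≤ q) {ω : ℝ} (h0 : 0 ≤ ω) (h1 : ω ≤ 1)
    (c : (KeyIndex M₁ M₂ → Fin n → Fin q) → TwoLevelCode q n M₁ M₂) :
    RandCode q n M₁ M₂ where
  κ := Fintype.card (KeyIndex M₁ M₂ → Fin n → Fin q)
  π i := ∏ j, wordWeight ω j ((Fintype.equivFin _).symm i j)
  π_nonneg _ := Finset.prod_nonneg fun _ _ => wordWeight_nonneg hq h0 h1 _ _
  π_sum := (Equiv.sum_comp (Fintype.equivFin (KeyIndex M₁ M₂ → Fin n → Fin q)).symm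
    fun k => ∏ j, wordWeight ω j (k j)).trans (sum_prod_weights (sum_wordWeight hq ω))
  code i := c ((Fintype.equivFin _).symm i)

open scoped Classical in
lemma e1_randCodeOf (hq : 3 ≤ q) {ω : ℝ} (h0 : 0 ≤ ω) (h1 : ω ≤ 1)
    (c : (KeyIndex M₁ M₂ → Fin n → Fin q) → TwoLevelCode q n M₁ M₂)
    (u : Fin m → Fin M₁ × Fin M₂) (V : (Fin m → Fin n → Fin q) → (Fin n → Fin q) → ℝ) :
    e1 (randCodeOf hq h0 h1 c) u V = prodE (wordWeight ω) fun k =>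
      ∑ y ∈ Finset.univ.filter (fun y => ¬ ∃ i, (c k).dec1 y = some (u i).1),
        V (fun i => (c k).enc (u i)) y :=
  Equiv.sum_comp (Fintype.equivFin (KeyIndex M₁ M₂ → Fin n → Fin q)).symm
    fun k => (∏ j, wordWeight ω j (k j)) *
      ∑ y ∈ Finset.univ.filter (fun y => ¬ ∃ i, (c k).dec1 y = some (u i).1),
        V (fun i => (c k).enc (u i)) y

open scoped Classical in
lemma e2_randCodeOf (hq : 3 ≤ q) {ω : ℝ} (h0 : 0 ≤ ω) (h1 : ω ≤ 1)
    (c : (KeyIndex M₁ M₂ → Fin n → Fin q) → TwoLevelCode q n M₁ M₂)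
    (u : Fin m → Fin M₁ × Fin M₂) (V : (Fin m → Fin n → Fin q) → (Fin n → Fin q) → ℝ) :
    e2 (randCodeOf hq h0 h1 c) u V = prodE (wordWeight ω) fun k =>
      ∑ y ∈ Finset.univ.filter (fun y => ¬ ∃ i, (c k).dec2 y = some (u i)),
        V (fun i => (c k).enc (u i)) y :=
  Equiv.sum_comp (Fintype.equivFin (KeyIndex M₁ M₂ → Fin n → Fin q)).symm
    fun k => (∏ j, wordWeight ω j (k j)) *
      ∑ y ∈ Finset.univ.filter (fun y => ¬ ∃ i, (c k).dec2 y = some (u i)),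
        V (fun i => (c k).enc (u i)) y

/-- User `v` has noise of typical weight. -/
def HasTypicalNoise (ω s : ℝ) (k : KeyIndex M₁ M₂ → Fin n → Fin q) (v : Fin M₁ × Fin M₂) :
    Prop :=
  |(hammingNorm (k (Sum.inr v)) : ℝ) - ω * n| ≤ s * n

/-- Among the users with typical noise, `v` has a fingerprint nearest to `y`. -/
def IsNearest (ω s : ℝ) (k : KeyIndex M₁ M₂ → Fin n → Fin q) (y : Fin n → Fin q)
    (v : Fin M₁ × Fin M₂) : Prop :=
  HasTypicalNoise ω s k v ∧ ∀ w, HasTypicalNoise ω s k w →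
    hammingDist (fingerprint k v) y ≤ hammingDist (fingerprint k w) y

open scoped Classical in
/-- The two-level code with key `k`: the group decoder returns a group whose center is within
`ρ n` of `y`, the user decoder a nearest fingerprint among the users with typical noise. -/
noncomputable def keyCode (ω s ρ : ℝ) (k : KeyIndex M₁ M₂ → Fin n → Fin q) :
    TwoLevelCode q n M₁ M₂ where
  enc := fingerprint k
  dec1 y := if h : ∃ i, (hammingDist (k (Sum.inl i)) y : ℝ) ≤ ρ * n then some h.choose
    else none
  dec2 y := if h : ∃ v, IsNearest ω s k y v then some h.choose else none

lemma exists_dec1_eq_some {ω s ρ : ℝ} {k : KeyIndex M₁ M₂ → Fin n → Fin q}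
    {y : Fin n → Fin q} {i : Fin M₁} (hi : (hammingDist (k (Sum.inl i)) y : ℝ) ≤ ρ * n) :
    ∃ j, (keyCode ω s ρ k).dec1 y = some j ∧
      (hammingDist (k (Sum.inl j)) y : ℝ) ≤ ρ * n := by
  have h : ∃ i, (hammingDist (k (Sum.inl i)) y : ℝ) ≤ ρ * n := ⟨i, hi⟩
  exact ⟨h.choose, dif_pos h, h.choose_spec⟩

lemma exists_dec2_eq_some {ω s ρ : ℝ} {k : KeyIndex M₁ M₂ → Fin n → Fin q}
    (y : Fin n → Fin q) {v : Fin M₁ × Fin M₂} (hv : HasTypicalNoise ω s k v) :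
    ∃ w, (keyCode ω s ρ k).dec2 y = some w ∧ IsNearest ω s k y w := by
  classical
  have h : ∃ w, IsNearest ω s k y w := by
    obtain ⟨w, hw, hmin⟩ := Finset.exists_min_image
      (Finset.univ.filter fun w => HasTypicalNoise ω s k w)
      (fun w => hammingDist (fingerprint k w) y) ⟨v, by simpa using hv⟩
    exact ⟨w, by simpa using hw, fun w' hw' => hmin w' (by simpa using hw')⟩
  exact ⟨h.choose, dif_pos h, h.choose_spec⟩

lemma hammingDist_center_le (k : KeyIndex M₁ M₂ → Fin n → Fin q) (y : Fin n → Fin q)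
    (v : Fin M₁ × Fin M₂) : hammingDist (k (Sum.inl v.1)) y ≤
      hammingNorm (k (Sum.inr v)) + hammingDist (fingerprint k v) y := by
  refine (hammingDist_triangle _ (fingerprint k v) _).trans (Nat.add_le_add_right ?_ _)
  refine Finset.card_le_card fun l hl => ?_
  simpa [fingerprint] using hl

lemma hammingDist_center_le_mul {ω s D ρ : ℝ} (hρ : D + ω + s ≤ ρ)
    {k : KeyIndex M₁ M₂ → Fin n → Fin q} {y : Fin n → Fin q} {v : Fin M₁ × Fin M₂}
    (hv : HasTypicalNoise ω s k v) (hd : (hammingDist (fingerprint k v) y : ℝ) ≤ D * n) :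
    (hammingDist (k (Sum.inl v.1)) y : ℝ) ≤ ρ * n := by
  have h := (Nat.cast_le (α := ℝ)).2 (hammingDist_center_le k y v)
  push_cast at h
  have h2 := (abs_le.1 hv).2
  have h3 : (D + ω + s) * n ≤ ρ * n := mul_le_mul_of_nonneg_right hρ (Nat.cast_nonneg n)
  linarith

/-- The center of a group outside the coalition `u` is close to `y`. -/
def HasBadCenter (ρ : ℝ) (u : Fin m → Fin M₁ × Fin M₂)
    (k : KeyIndex M₁ M₂ → Fin n → Fin q) (y : Fin n → Fin q) : Prop :=
  ∃ g, (∀ i, (u i).1 ≠ g) ∧ (hammingDist (k (Sum.inl g)) y : ℝ) ≤ ρ * n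

/-- The fingerprint of an innocent user with typical noise in a group of the coalition `u`
is close to `y`. -/
def HasBadUser (ω s D : ℝ) (u : Fin m → Fin M₁ × Fin M₂)
    (k : KeyIndex M₁ M₂ → Fin n → Fin q) (y : Fin n → Fin q) : Prop :=
  ∃ ia : Fin m × Fin M₂, (∀ j, ((u ia.1).1, ia.2) ≠ u j) ∧
    HasTypicalNoise ω s k ((u ia.1).1, ia.2) ∧
    (hammingDist (fingerprint k ((u ia.1).1, ia.2)) y : ℝ) ≤ D * n

lemma obsP_hasBadCenter_le (hq : 3 ≤ q) {ω ρ : ℝ} (h0 : 0 ≤ ω) (h1 : ω ≤ 1) (hρ0 : 0 < ρ)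
    (hρ : ρ ≤ ((q : ℝ) - 1) / q) (u : Fin m → Fin M₁ × Fin M₂)
    {V : (Fin m → Fin n → Fin q) → (Fin n → Fin q) → ℝ} (hV : Admissible V) :
    obsP (wordWeight ω) (fun k => V fun i => fingerprint k (u i)) (HasBadCenter ρ u) ≤
      M₁ * (q : ℝ) ^ (-((n : ℝ) * (1 - qEntropy q ρ))) := by
  have hq0 : (0 : ℝ) < q := by exact_mod_cast (by omega : 0 < q)
  refine (obsP_exists_le (wordWeight_nonneg hq h0 h1) (fun _ _ => hV.1 _ _) _).trans
    ((Finset.sum_le_card_nsmul _ _ ((q : ℝ) ^ (-((n : ℝ) * (1 - qEntropy q ρ))))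
      fun g _ => ?_).trans_eq (by simp))
  by_cases hg : ∀ i, (u i).1 ≠ g
  · refine obsP_le_of_resample_le (wordWeight_nonneg hq h0 h1) (sum_wordWeight hq ω) (Sum.inl g)
      (fun k => V fun i => fingerprint k (u i)) _ ?_ (fun _ _ => hV.1 _ _) (fun _ => (hV.2.1 _).le) (Real.rpow_nonneg hq0.le _) ?_
    · intro k a y
      have : ∀ i, fingerprint (Function.update k (Sum.inl g) a) (u i) = fingerprint k (u i) := by
        intro i
        have hne : (Sum.inl (u i).1 : KeyIndex M₁ M₂) ≠ Sum.inl g := fun h => hg i (Sum.inl.inj h)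
        simp [fingerprint, Function.update_of_ne hne]
      simp only [this]
    · intro k y _
      refine le_trans (le_of_eq ?_) (uniform_ball_le hq y hρ0 hρ)
      refine Finset.sum_congr rfl fun a _ => ?_
      simp [wordWeight, symbolWeight, hg]
  · have : ∀ y : Fin n → Fin q, ∀ k : KeyIndex M₁ M₂ → Fin n → Fin q,
        ¬ ((∀ i, (u i).1 ≠ g) ∧ (hammingDist (k (Sum.inl g)) y : ℝ) ≤ ρ * n) :=
      fun _ _ h => hg h.1
    simp only [obsP, this, if_false, mul_zero, Finset.sum_const_zero]
    rw [prodE_const (sum_wordWeight hq ω)]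
    exact Real.rpow_nonneg hq0.le _

lemma obsP_hasBadUser_le (hq : 3 ≤ q) (hn : 0 < n) {ω s pe lo hi D M : ℝ} (h0 : 0 < ω)
    (h1 : ω < 1) (u : Fin m → Fin M₁ × Fin M₂)
    (hM : ∀ w γ α β, AdmissibleParams w γ α β → |w - ω| ≤ s → lo - s ≤ γ → γ ≤ hi + s →
      γ - β + α ≤ D → phi q w γ α β ≤ M)
    {V : (Fin m → Fin n → Fin q) → (Fin n → Fin q) → ℝ} (hV : Admissible V) :
    obsP (wordWeight ω) (fun k => V fun i => fingerprint k (u i))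
      (fun k y => IsTypicalKey ω s pe lo hi u k ∧ HasBadUser ω s D u k y) ≤
      m * M₂ * (((n : ℝ) + 1) ^ 3 * ((q : ℝ) ^ ((n : ℝ) * M) *
        (q : ℝ) ^ (-((n : ℝ) * (qEntropy q ω -
        s * |Real.logb q (ω / ((q : ℝ) - 1)) - Real.logb q (1 - ω)|))))) := by
  classical
  have hq0 : (0 : ℝ) < q := by exact_mod_cast (by omega : 0 < q)
  have hn0 : (0 : ℝ) < n := by exact_mod_cast hn
  have hw0 := wordWeight_nonneg (n := n) (M₁ := M₁) (M₂ := M₂) hq h0.le h1.le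
  set b := ((n : ℝ) + 1) ^ 3 * ((q : ℝ) ^ ((n : ℝ) * M) *
        (q : ℝ) ^ (-((n : ℝ) * (qEntropy q ω -
        s * |Real.logb q (ω / ((q : ℝ) - 1)) - Real.logb q (1 - ω)|)))) with hb
  have hb0 : 0 ≤ b := by positivity
  set W : (KeyIndex M₁ M₂ → Fin n → Fin q) → (Fin n → Fin q) → ℝ := fun k y =>
    if IsTypicalKey ω s pe lo hi u k then V (fun i => fingerprint k (u i)) y else 0 with hW
  have hW0 : ∀ k y, 0 ≤ W k y := fun k y => by
    simp only [hW]; split_ifs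
    · exact hV.1 _ _
    · rfl
  have hW1 : ∀ k, ∑ y, W k y ≤ 1 := fun k => by
    simp only [hW]; split_ifs
    · exact (hV.2.1 _).le
    · simp
  have hcond : obsP (wordWeight ω) (fun k => V fun i => fingerprint k (u i))
      (fun k y => IsTypicalKey ω s pe lo hi u k ∧ HasBadUser ω s D u k y) =
      obsP (wordWeight ω) W (HasBadUser ω s D u) := by
    simp only [obsP, hW]
    congr 1
    funext k
    refine Finset.sum_congr rfl fun y _ => ?_
    by_cases hT : IsTypicalKey ω s pe lo hi u k <;> simp [hT]
  rw [hcond]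
  refine (obsP_exists_le hw0 hW0 _).trans
    ((Finset.sum_le_card_nsmul _ _ b fun ia _ => ?_).trans_eq (by simp))
  obtain ⟨i, a⟩ := ia
  dsimp only
  by_cases hg : ∀ j, ((u i).1, a) ≠ u j
  · refine obsP_le_of_resample_le hw0 (sum_wordWeight hq ω) (Sum.inr ((u i).1, a))
      W _ ?_ hW0 hW1 hb0 ?_
    · intro k z y
      have : ∀ j, fingerprint (Function.update k (Sum.inr ((u i).1, a)) z) (u j) =
          fingerprint k (u j) := by
        intro j
        have hne : (Sum.inr (u j) : KeyIndex M₁ M₂) ≠ Sum.inr ((u i).1, a) :=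
          fun h => hg j (Sum.inr.inj h).symm
        simp [fingerprint, Function.update_of_ne hne]
      simp only [hW, this, isTypicalKey_update ω s pe lo hi u _ hg]
    · intro k y hk
      have hT : IsTypicalKey ω s pe lo hi u k := by
        by_contra hT
        exact hk (if_neg hT)
      have hy : InEnvelope (fun i => fingerprint k (u i)) y := by
        by_contra hy
        refine hk ?_
        simp only [hW, hT, if_true]
        exact hV.2.2 _ _ hy
      obtain ⟨hlo, hhi⟩ := hT.hammingDist_center hy i
      have hnorm : hammingNorm (y - k (Sum.inl (u i).1)) =
          hammingDist y (k (Sum.inl (u i).1)) := by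
        simp [hammingNorm, hammingDist, sub_eq_zero]
      refine le_trans (le_of_eq ?_) (noise_ball_le hq hn (s := s) (D := D) (M := M) h0 h1
        (y - k (Sum.inl (u i).1)) fun w α β hadm hw hD => hM w _ α β hadm hw ?_ ?_ hD)
      · refine Finset.sum_congr rfl fun z _ => ?_
        have hz : hammingDist (k (Sum.inl (u i).1) + z) y =
            hammingDist z (y - k (Sum.inl (u i).1)) := by
          simp [hammingDist, ← eq_sub_iff_add_eq']
        simp only [fingerprint, HasTypicalNoise, Function.update_self, ne_eq, reduceCtorEq,
          not_false_eq_true, Function.update_of_ne, hz]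
        simp [wordWeight, symbolWeight, hg]
      · rw [hnorm, le_div_iff₀ hn0]; linarith
      · rw [hnorm, div_le_iff₀ hn0]; linarith
  · have : ∀ y : Fin n → Fin q, ∀ k : KeyIndex M₁ M₂ → Fin n → Fin q,
        ¬ ((∀ j, ((u i).1, a) ≠ u j) ∧ HasTypicalNoise ω s k ((u i).1, a) ∧
        (hammingDist (fingerprint k ((u i).1, a)) y : ℝ) ≤ D * n) :=
      fun _ _ h => hg h.1
    simp only [obsP, this, if_false, mul_zero, Finset.sum_const_zero]
    rw [prodE_const (sum_wordWeight hq ω)]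
    exact hb0

lemma e1_keyCode_le (hq : 3 ≤ q) {ω s pe lo hi D ρ : ℝ} (h0 : 0 ≤ ω) (h1 : ω ≤ 1)
    (hρ0 : 0 < ρ) (hρ : ρ ≤ ((q : ℝ) - 1) / q) (hm : 0 < m) (u : Fin m → Fin M₁ × Fin M₂)
    (hD : ((m : ℝ) - 1) / m * (1 - pe + s) ≤ D) (hDρ : D + ω + s ≤ ρ)
    {V : (Fin m → Fin n → Fin q) → (Fin n → Fin q) → ℝ} (hV : Admissible V) :
    e1 (randCodeOf hq h0 h1 (keyCode ω s ρ)) u V ≤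
      prodP (wordWeight ω) (fun k : KeyIndex M₁ M₂ → Fin n → Fin q =>
        ¬ IsTypicalKey ω s pe lo hi u k) +
      M₁ * (q : ℝ) ^ (-((n : ℝ) * (1 - qEntropy q ρ))) := by
  classical
  rw [e1_randCodeOf]
  refine (prodE_sum_filter_le (A := fun k => V fun i => fingerprint k (u i))
    (wordWeight_nonneg hq h0 h1) (fun _ _ => hV.1 _ _) (fun _ => hV.2.1 _)
    (IsTypicalKey ω s pe lo hi u) _ (HasBadCenter ρ u) ?_).trans
    (add_le_add_right (obsP_hasBadCenter_le hq h0 h1 hρ0 hρ u hV) _)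
  intro k y hT hy hfail
  have hy' : InEnvelope (fun i => fingerprint k (u i)) y := by
    by_contra hcon
    exact hy (hV.2.2 _ _ hcon)
  obtain ⟨i, hi⟩ := hT.exists_hammingDist_le hm hD hy'
  obtain ⟨g, hg, hd⟩ := exists_dec1_eq_some (ω := ω) (s := s)
    (hammingDist_center_le_mul hDρ (hT.abs_hammingNorm_sub_le i) hi)
  exact ⟨g, fun j hj => hfail ⟨j, hg.trans (by rw [hj])⟩, hd⟩

lemma e2_keyCode_le (hq : 3 ≤ q) (hn : 0 < n) {ω s pe lo hi D ρ M : ℝ} (h0 : 0 < ω)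
    (h1 : ω < 1) (hρ0 : 0 < ρ) (hρ : ρ ≤ ((q : ℝ) - 1) / q) (hm : 0 < m)
    (u : Fin m → Fin M₁ × Fin M₂)
    (hD : ((m : ℝ) - 1) / m * (1 - pe + s) ≤ D) (hDρ : D + ω + s ≤ ρ)
    (hM : ∀ w γ α β, AdmissibleParams w γ α β → |w - ω| ≤ s → lo - s ≤ γ → γ ≤ hi + s →
      γ - β + α ≤ D → phi q w γ α β ≤ M)
    {V : (Fin m → Fin n → Fin q) → (Fin n → Fin q) → ℝ} (hV : Admissible V) :
    e2 (randCodeOf hq h0.le h1.le (keyCode ω s ρ)) u V ≤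
      prodP (wordWeight ω) (fun k : KeyIndex M₁ M₂ → Fin n → Fin q =>
        ¬ IsTypicalKey ω s pe lo hi u k) +
      (M₁ * (q : ℝ) ^ (-((n : ℝ) * (1 - qEntropy q ρ))) +
      m * M₂ * (((n : ℝ) + 1) ^ 3 * ((q : ℝ) ^ ((n : ℝ) * M) *
        (q : ℝ) ^ (-((n : ℝ) * (qEntropy q ω -
        s * |Real.logb q (ω / ((q : ℝ) - 1)) - Real.logb q (1 - ω)|)))))) := by
  classical
  rw [e2_randCodeOf]
  refine (prodE_sum_filter_le (A := fun k => V fun i => fingerprint k (u i))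
    (wordWeight_nonneg hq h0.le h1.le) (fun _ _ => hV.1 _ _) (fun _ => hV.2.1 _)
    (IsTypicalKey ω s pe lo hi u) _ (fun k y => HasBadCenter ρ u k y ∨
      (IsTypicalKey ω s pe lo hi u k ∧ HasBadUser ω s D u k y)) ?_).trans
    (add_le_add_right ((obsP_or_le (wordWeight_nonneg hq h0.le h1.le)
      (fun _ _ => hV.1 _ _) _ _).trans
      (add_le_add (obsP_hasBadCenter_le hq h0.le h1.le hρ0 hρ u hV)
        (obsP_hasBadUser_le hq hn h0 h1 u hM hV))) _)
  intro k y hT hy hfail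
  have hy' : InEnvelope (fun i => fingerprint k (u i)) y := by
    by_contra hcon
    exact hy (hV.2.2 _ _ hcon)
  obtain ⟨i, hi⟩ := hT.exists_hammingDist_le hm hD hy'
  have hti : HasTypicalNoise ω s k (u i) := hT.abs_hammingNorm_sub_le i
  obtain ⟨w, hw, htw, hmin⟩ := exists_dec2_eq_some (ρ := ρ) y hti
  have hwd : (hammingDist (fingerprint k w) y : ℝ) ≤ D * n :=
    (Nat.cast_le.2 (hmin _ hti)).trans hi
  have hwu : ∀ j, w ≠ u j := fun j hj => hfail ⟨j, hw.trans (by rw [hj])⟩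
  by_cases hg : ∃ j, (u j).1 = w.1
  · obtain ⟨j, hj⟩ := hg
    have hwj : ((u j).1, w.2) = w := by rw [hj]
    exact Or.inr ⟨hT, (j, w.2), by simpa only [hwj] using hwu, by rwa [hwj], by rwa [hwj]⟩
  · exact Or.inl ⟨w.1, fun j hj => hg ⟨j, hj⟩, hammingDist_center_le_mul hDρ htw hwd⟩

end RandomCode

section Achievability

variable {q n M₁ M₂ m : ℕ}

lemma mul_one_sub_pow_mono (hq : 3 ≤ q) {t : ℕ} (hm : 0 < m) (hmt : m ≤ t) :
    ((m : ℝ) - 1) / m * (1 - 1 / (q : ℝ) ^ (m - 1)) ≤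
      ((t : ℝ) - 1) / t * (1 - 1 / (q : ℝ) ^ (t - 1)) := by
  have hq' : (3 : ℝ) ≤ q := by exact_mod_cast hq
  have hm' : (1 : ℝ) ≤ m := by exact_mod_cast hm
  have hmt' : (m : ℝ) ≤ t := by exact_mod_cast hmt
  have hpow : (q : ℝ) ^ (m - 1) ≤ q ^ (t - 1) :=
    pow_le_pow_right₀ (by linarith) (by omega)
  have h1 : (1 : ℝ) ≤ q ^ (m - 1) := one_le_pow₀ (by linarith)
  refine mul_le_mul ?_ ?_ ?_ ?_
  · rw [div_le_div_iff₀ (by linarith) (by linarith)]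
    nlinarith
  · exact sub_le_sub_left (one_div_le_one_div_of_le (by linarith) hpow) _
  · rw [sub_nonneg, div_le_one (by linarith)]
    exact h1
  · exact div_nonneg (by linarith) (by linarith)

lemma delta1_nonneg (hq : 3 ≤ q) {ω : ℝ} (h0 : 0 ≤ ω) (h1 : ω ≤ 1) : 0 ≤ delta1 q ω := by
  have hq' : (3 : ℝ) ≤ q := by exact_mod_cast hq
  have : ω ^ 2 / ((q : ℝ) - 1) ≤ ω ^ 2 / 2 :=
    div_le_div_of_nonneg_left (sq_nonneg ω) (by norm_num) (by linarith)
  unfold delta1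
  nlinarith

lemma delta1_le_delta2 (hq : 3 ≤ q) (ω : ℝ) : delta1 q ω ≤ delta2 q ω := by
  have hq' : (3 : ℝ) ≤ q := by exact_mod_cast hq
  have hq0 : (q : ℝ) ≠ 0 := by linarith
  have hq1 : 0 < (q : ℝ) - 1 := by linarith
  have : (1 - ω) ^ 2 + ω ^ 2 / ((q : ℝ) - 1) - 1 / q =
      (q * ω - (q - 1)) ^ 2 / (q * ((q : ℝ) - 1)) := by
    field_simp
    ring
  have h : 0 ≤ (q * ω - (q - 1)) ^ 2 / (q * ((q : ℝ) - 1)) := by positivity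
  unfold delta1 delta2
  linarith

lemma delta2_le (hq : 3 ≤ q) (ω : ℝ) {t : ℕ} (ht : 2 ≤ t) :
    delta2 q ω ≤ ((t : ℝ) - 1) / t * (1 - 1 / (q : ℝ) ^ (t - 1)) := by
  refine le_of_eq_of_le ?_ (mul_one_sub_pow_mono hq two_pos ht)
  norm_num [delta2]
  ring

lemma qEntropy_sub_one_div (hq : 3 ≤ q) : qEntropy q (((q : ℝ) - 1) / q) = 1 := by
  have hq' : (3 : ℝ) ≤ q := by exact_mod_cast hq
  have hq0 : (q : ℝ) ≠ 0 := by linarith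
  have hq1 : (q : ℝ) - 1 ≠ 0 := by linarith
  have e1 : ((q : ℝ) - 1) / q / (q - 1) = (q : ℝ)⁻¹ := by field_simp
  have e2 : 1 - ((q : ℝ) - 1) / q = (q : ℝ)⁻¹ := by field_simp; ring
  rw [qEntropy, e1, e2, Real.logb_inv, Real.logb_self_eq_one (by linarith)]
  field_simp
  ring

lemma continuousAt_qEntropy (hq : 3 ≤ q) {x : ℝ} (h0 : 0 < x) (h1 : x < 1) :
    ContinuousAt (qEntropy q) x := by
  have hq' : (3 : ℝ) ≤ q := by exact_mod_cast hq
  have hq1 : 0 < (q : ℝ) - 1 := by linarith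
  have e1 : ContinuousAt (fun x => Real.logb q (x / ((q : ℝ) - 1))) x :=
    ContinuousAt.logb (by fun_prop) (by positivity)
  have e2 : ContinuousAt (fun x => Real.logb q (1 - x)) x :=
    ContinuousAt.logb (by fun_prop) (by linarith)
  unfold qEntropy
  fun_prop

lemma e1_keyCode_le_of_injective [NeZero q] (hq : 3 ≤ q) (hn : 0 < n) {t : ℕ} {ω s ρ : ℝ}
    (h0 : 0 ≤ ω) (h1 : ω ≤ 1) (hs : 0 < s)
    (hρ : ((t : ℝ) - 1) / t * (1 - 1 / (q : ℝ) ^ (t - 1)) + ω + 2 * s ≤ ρ)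
    (hρ0 : 0 < ρ) (hρq : ρ ≤ ((q : ℝ) - 1) / q) (hm : 0 < m) (hmt : m ≤ t)
    (u : Fin m → Fin M₁ × Fin M₂) (hu : Function.Injective u)
    {V : (Fin m → Fin n → Fin q) → (Fin n → Fin q) → ℝ} (hV : Admissible V) :
    e1 (randCodeOf hq h0 h1 (keyCode ω s ρ)) u V ≤
      (1 + 4 * t) * (1 / (n * s ^ 2)) +
      M₁ * (q : ℝ) ^ (-((n : ℝ) * (1 - qEntropy q ρ))) := by
  have hm' : (1 : ℝ) ≤ m := by exact_mod_cast hm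
  have hmt' : (m : ℝ) ≤ t := by exact_mod_cast hmt
  have hsym : ∀ (j : KeyIndex M₁ M₂) (a : Fin q), 0 ≤ symbolWeight q ω j a :=
    symbolWeight_nonneg hq h0 h1
  have hcoef : ((m : ℝ) - 1) / m ≤ 1 := by rw [div_le_one (by linarith)]; linarith
  have hT := prodP_not_isTypicalKey_le (lo := 0) (hi := 1) hq hn h0 h1 hs u
    (prodP_all_eq_ge hq h0 h1 hm u hu) (fun _ => prodP_nonneg hsym _)
    (fun _ => (sub_self (1 : ℝ)).trans_le (prodP_nonneg hsym _))
  have hmono := mul_one_sub_pow_mono hq hm hmt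
  refine (e1_keyCode_le (D := ((t : ℝ) - 1) / t * (1 - 1 / (q : ℝ) ^ (t - 1)) + s) hq h0 h1
    hρ0 hρq hm u ?_ (by linarith) hV).trans (add_le_add_left (hT.trans ?_) _)
  · rw [mul_add]
    exact add_le_add hmono (mul_le_of_le_one_left hs.le hcoef)
  · gcongr

/-- The user-tracing error of a coalition of size at most two, in terms of a bound `M` for
`φ` near the regions that define `f₁` and `f₂`. -/
lemma e2_keyCode_le_of_injective [NeZero q] (hq : 3 ≤ q) (hn : 0 < n) {t : ℕ} (ht : 2 ≤ t)
    {ω s ρ M : ℝ} (h0 : 0 < ω) (h1 : ω < 1) (hs : 0 < s)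
    (hρ : ((t : ℝ) - 1) / t * (1 - 1 / (q : ℝ) ^ (t - 1)) + ω + 2 * s ≤ ρ)
    (hρ0 : 0 < ρ) (hρq : ρ ≤ ((q : ℝ) - 1) / q)
    (hf1 : ∀ w γ α β, AdmissibleParams w γ α β → |w - ω| ≤ s → ω ^ 2 - s ≤ γ →
      γ ≤ 1 - (1 - ω) ^ 2 + s → γ - β + α ≤ delta1 q ω + s → phi q w γ α β ≤ M)
    (hf2 : ∀ w γ α β, AdmissibleParams w γ α β → |w - ω| ≤ s →
      ω * ((q : ℝ) - 1) / q - s ≤ γ → γ ≤ 1 - (1 - ω) / q + s →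
      γ - β + α ≤ delta2 q ω + s → phi q w γ α β ≤ M)
    (hm : 0 < m) (hm2 : m ≤ 2) (u : Fin m → Fin M₁ × Fin M₂) (hu : Function.Injective u)
    {V : (Fin m → Fin n → Fin q) → (Fin n → Fin q) → ℝ} (hV : Admissible V) :
    e2 (randCodeOf hq h0.le h1.le (keyCode ω s ρ)) u V ≤
      (1 + 4 * t) * (1 / (n * s ^ 2)) +
      (M₁ * (q : ℝ) ^ (-((n : ℝ) * (1 - qEntropy q ρ))) +
      2 * M₂ * (((n : ℝ) + 1) ^ 3 * ((q : ℝ) ^ ((n : ℝ) * M) *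
        (q : ℝ) ^ (-((n : ℝ) * (qEntropy q ω -
        s * |Real.logb q (ω / ((q : ℝ) - 1)) - Real.logb q (1 - ω)|)))))) := by
  have hq' : (3 : ℝ) ≤ q := by exact_mod_cast hq
  have hmt' : (m : ℝ) ≤ t := by exact_mod_cast hm2.trans ht
  have hm2' : (m : ℝ) ≤ 2 := by exact_mod_cast hm2
  have hsym : ∀ (j : KeyIndex M₁ M₂) (a : Fin q), 0 ≤ symbolWeight q ω j a :=
    symbolWeight_nonneg hq h0.le h1.le
  have hd12 := delta1_le_delta2 hq ω
  have hd2 := delta2_le hq ω ht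
  have key : ∀ {pe lo hi D : ℝ},
      pe ≤ prodP (symbolWeight q ω) (fun c => ∃ a, ∀ i, fingerprint c (u i) = a) →
      (∀ i, lo ≤ prodP (symbolWeight q ω)
        fun c => ∀ j, fingerprint c (u j) ≠ c (Sum.inl (u i).1)) →
      (∀ i, 1 - hi ≤ prodP (symbolWeight q ω)
        fun c => ∀ j, fingerprint c (u j) = c (Sum.inl (u i).1)) →
      ((m : ℝ) - 1) / m * (1 - pe + s) ≤ D + s → D ≤ delta2 q ω →
      (∀ w γ α β, AdmissibleParams w γ α β → |w - ω| ≤ s → lo - s ≤ γ → γ ≤ hi + s →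
        γ - β + α ≤ D + s → phi q w γ α β ≤ M) →
      e2 (randCodeOf hq h0.le h1.le (keyCode ω s ρ)) u V ≤
      (1 + 4 * t) * (1 / (n * s ^ 2)) +
      (M₁ * (q : ℝ) ^ (-((n : ℝ) * (1 - qEntropy q ρ))) +
      2 * M₂ * (((n : ℝ) + 1) ^ 3 * ((q : ℝ) ^ ((n : ℝ) * M) *
        (q : ℝ) ^ (-((n : ℝ) * (qEntropy q ω -
        s * |Real.logb q (ω / ((q : ℝ) - 1)) - Real.logb q (1 - ω)|)))))) := by
    intro pe lo hi D hpe hlo hhi hD hDle hM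
    have hT := prodP_not_isTypicalKey_le hq hn h0.le h1.le hs u hpe hlo hhi
    refine (e2_keyCode_le hq hn h0 h1 hρ0 hρq hm u hD (by linarith) hM hV).trans
      (add_le_add (hT.trans ?_) (add_le_add_right ?_ _))
    · gcongr
    · gcongr
  have hfix : ∀ {v w : Fin M₁ × Fin M₂} (c : KeyIndex M₁ M₂ → Fin q), v.1 = w.1 →
      (fingerprint c v = c (Sum.inl w.1) ↔ c (Sum.inr v) = 0) := by
    intro v w c hvw
    simp [fingerprint, hvw]
  obtain rfl | rfl : m = 1 ∨ m = 2 := by omega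
  · have hv : ∀ i j, (u j).1 = (u i).1 := fun i j => by rw [Subsingleton.elim i j]
    have hd1 := delta1_nonneg hq h0.le h1.le
    refine key (D := delta1 q ω) (prodP_all_eq_ge hq h0.le h1.le hm u hu) (fun i => ?_)
      (fun i => ?_) ?_ hd12 hf1
    · refine le_trans ?_ (prodP_mono hsym (A := fun c => c (Sum.inr (u i)) ≠ 0) fun c hc j => ?_)
      · rw [prodP_noise hq (u i) (fun a => a ≠ 0), sum_noise_mul_ite_ne_zero hq]
        nlinarith
      · rwa [Ne, hfix c (hv i j), Subsingleton.elim j i]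
    · refine le_trans ?_ (prodP_mono hsym (A := fun c => c (Sum.inr (u i)) = 0) fun c hc j => ?_)
      · rw [prodP_noise hq (u i) (fun a => a = 0), sum_noise_mul_ite_zero]
        nlinarith
      · rwa [hfix c (hv i j), Subsingleton.elim j i]
    · norm_num
      linarith
  have hu01 : u 0 ≠ u 1 := fun h => by simpa using hu h
  by_cases hg : (u 0).1 = (u 1).1
  · have hv : ∀ i j, (u j).1 = (u i).1 := by
      simp [Fin.forall_fin_two, hg]
    refine key (pe := (1 - ω) ^ 2 + ω ^ 2 / ((q : ℝ) - 1)) (D := delta1 q ω) ?_ (fun i => ?_)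
      (fun i => ?_) ?_ hd12 hf1
    · refine (prodP_noise_eq hq hu01).ge.trans (prodP_mono hsym fun c hc =>
        ⟨fingerprint c (u 0), ?_⟩)
      simp [Fin.forall_fin_two, fingerprint, hg, hc]
    · refine le_trans ?_ ((prodP_noise_and hq hu01 (fun a => a ≠ 0)
        (fun a => a ≠ 0)).ge.trans (prodP_mono hsym fun c hc => ?_))
      · rw [sum_noise_mul_ite_ne_zero hq, sq]
      · simpa only [Fin.forall_fin_two, Ne, hfix c (hv i _)] using hc
    · refine le_trans ?_ ((prodP_noise_and hq hu01 (fun a => a = 0)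
        (fun a => a = 0)).ge.trans (prodP_mono hsym fun c hc => ?_))
      · rw [sum_noise_mul_ite_zero, sub_sub_cancel, sq]
      · simpa only [Fin.forall_fin_two, hfix c (hv i _)] using hc
    · norm_num [delta1]
      linarith
  · have huni : ∑ a : Fin q, 1 / (q : ℝ) * (if a = 0 then 1 else 0) = 1 / q := by simp
    have huni' : ∑ a : Fin q, 1 / (q : ℝ) * (if a ≠ 0 then 1 else 0) = (q - 1) / q := by
      have hsplit : ∀ a : Fin q, 1 / (q : ℝ) * (if a ≠ 0 then 1 else 0) =
          1 / q - 1 / (q : ℝ) * (if a = 0 then 1 else 0) := fun a => by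
        by_cases ha : a = 0 <;> simp [ha]
      simp only [hsplit]
      rw [Finset.sum_sub_distrib, huni, sum_uniform, sub_div, div_self (by linarith)]
    have hpair : ∀ i : Fin 2, ∃ j, (u i).1 ≠ (u j).1 ∧ ∀ P : Fin 2 → Prop, P i → P j →
        ∀ l, P l := by
      simp only [Fin.forall_fin_two, Fin.exists_fin_two]
      exact ⟨Or.inr ⟨hg, fun P h0 h1 => ⟨h0, h1⟩⟩, Or.inl ⟨Ne.symm hg, fun P h1 h0 => ⟨h0, h1⟩⟩⟩
    refine key (pe := 1 / q ^ (2 - 1)) (D := delta2 q ω)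
      (prodP_all_eq_ge hq h0.le h1.le hm u hu) (fun i => ?_) (fun i => ?_) ?_ le_rfl hf2
    · obtain ⟨j, hij, hP⟩ := hpair i
      refine le_trans ?_ ((prodP_noise_and_fingerprint hq hij (fun a => a ≠ 0)
        (fun a => a ≠ 0)).ge.trans (prodP_mono hsym fun c hc => hP _ ?_ ?_))
      · rw [sum_noise_mul_ite_ne_zero hq, huni', mul_div_assoc]
      · rw [Ne, hfix c rfl]; exact hc.1
      · exact sub_ne_zero.1 hc.2
    · obtain ⟨j, hij, hP⟩ := hpair i
      refine le_trans ?_ ((prodP_noise_and_fingerprint hq hij (fun a => a = 0)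
        (fun a => a = 0)).ge.trans (prodP_mono hsym fun c hc => hP _ ?_ ?_))
      · rw [sum_noise_mul_ite_zero, huni, sub_sub_cancel, mul_one_div]
      · rw [hfix c rfl]; exact hc.1
      · exact sub_eq_zero.1 hc.2
    · norm_num [delta2]
      linarith

end Achievability

section Parameters

variable {q t : ℕ} {R₁ R₂ ω : ℝ}

/-- The upper bound for the error probabilities vanishes as the length grows. -/
lemma tendsto_error_bound (hq : 3 ≤ q) (a b s : ℝ) {c : ℝ} (hc : 0 < c) :
    Filter.Tendsto (fun n : ℕ => a * (1 / (n * s ^ 2)) + ((q : ℝ) ^ (-((n : ℝ) * c)) +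
      b * (((n : ℝ) + 1) ^ 3 * (q : ℝ) ^ (-((n : ℝ) * c))))) Filter.atTop (nhds 0) := by
  have hq' : (3 : ℝ) ≤ q := by exact_mod_cast hq
  set r : ℝ := (q : ℝ) ^ (-c)
  have hr0 : 0 ≤ r := Real.rpow_nonneg (by linarith) _
  have hr1 : r < 1 := Real.rpow_lt_one_of_one_lt_of_neg (by linarith) (by linarith)
  have hr : ∀ n : ℕ, (q : ℝ) ^ (-((n : ℝ) * c)) = r ^ n := fun n => by
    rw [← Real.rpow_natCast, ← Real.rpow_mul (by linarith)]
    ring_nf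
  have hpow : ∀ k : ℕ, Filter.Tendsto (fun n : ℕ => (n : ℝ) ^ k * r ^ n) Filter.atTop (nhds 0) :=
    fun k => tendsto_pow_const_mul_const_pow_of_lt_one k hr0 hr1
  have hinv : Filter.Tendsto (fun n : ℕ => (n : ℝ)⁻¹) Filter.atTop (nhds 0) :=
    tendsto_inv_atTop_nhds_zero_nat
  have h := ((hinv.const_mul (a * (s ^ 2)⁻¹)).add ((hpow 0).add
    ((((hpow 3).add ((hpow 2).const_mul 3)).add ((hpow 1).const_mul 3)).add
      (hpow 0) |>.const_mul b)))
  simp only [mul_zero, add_zero] at h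
  refine h.congr fun n => ?_
  rw [hr, one_div, mul_inv]
  ring

/-- The parameters of the code: the slack `s`, a bound `M` for `φ` near the regions that
define `f₁` and `f₂`, and the exponent `c` of the error probability. -/
lemma exists_code_parameters (ht : 3 ≤ t) (hq : 3 ≤ q) (hR₁ : 0 ≤ R₁) (hR₂ : 0 ≤ R₂)
    (hω0 : 0 ≤ ω)
    (hωb : ((t : ℝ) - 1) / t * (1 - 1 / (q : ℝ) ^ (t - 1)) + ω ≤ ((q : ℝ) - 1) / q)
    (h1 : R₁ < 1 - qEntropy q (((t : ℝ) - 1) / t * (1 - 1 / (q : ℝ) ^ (t - 1)) + ω))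
    (h2 : R₂ < qEntropy q ω - max (f1 q ω) (f2 q ω)) :
    0 < ω ∧ ω < 1 ∧ ∃ s ρ M c : ℝ, 0 < s ∧ 0 < c ∧
      ((t : ℝ) - 1) / t * (1 - 1 / (q : ℝ) ^ (t - 1)) + ω + 2 * s ≤ ρ ∧ 0 < ρ ∧
      ρ ≤ ((q : ℝ) - 1) / q ∧ R₁ + c ≤ 1 - qEntropy q ρ ∧
      R₂ + M + c ≤ qEntropy q ω -
        s * |Real.logb q (ω / ((q : ℝ) - 1)) - Real.logb q (1 - ω)| ∧
      (∀ w γ α β, AdmissibleParams w γ α β → |w - ω| ≤ s → ω ^ 2 - s ≤ γ →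
        γ ≤ 1 - (1 - ω) ^ 2 + s → γ - β + α ≤ delta1 q ω + s → phi q w γ α β ≤ M) ∧
      (∀ w γ α β, AdmissibleParams w γ α β → |w - ω| ≤ s →
        ω * ((q : ℝ) - 1) / q - s ≤ γ → γ ≤ 1 - (1 - ω) / q + s →
        γ - β + α ≤ delta2 q ω + s → phi q w γ α β ≤ M) := by
  have hq' : (3 : ℝ) ≤ q := by exact_mod_cast hq
  have ht' : (3 : ℝ) ≤ t := by exact_mod_cast ht
  set δ := ((t : ℝ) - 1) / t * (1 - 1 / (q : ℝ) ^ (t - 1))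
  have hδ : 0 < δ := by
    refine mul_pos (div_pos (by linarith) (by linarith)) ?_
    rw [sub_pos, div_lt_one (by positivity)]
    exact one_lt_pow₀ (by linarith) (by omega)
  have hωpos : 0 < ω := by
    refine hω0.lt_of_ne fun h => ?_
    subst h
    have hphi : phi q 0 0 0 0 ≤ f1 q 0 :=
      phi_le_f1 hq (by simp [AdmissibleParams]) (by norm_num) (by norm_num) (by simp [delta1])
    have h0 : phi q 0 0 0 0 = 0 := by simp [phi, qEntropy]
    have h0' : qEntropy q 0 = 0 := by simp [qEntropy]
    linarith [le_max_left (f1 q 0) (f2 q 0)]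
  have hlt : δ + ω < ((q : ℝ) - 1) / q := by
    refine hωb.lt_of_ne fun h => ?_
    rw [h, qEntropy_sub_one_div hq] at h1
    linarith
  have hq1 : ((q : ℝ) - 1) / q < 1 := by rw [div_lt_one (by linarith)]; linarith
  refine ⟨hωpos, by linarith, ?_⟩
  set L := |Real.logb q (ω / ((q : ℝ) - 1)) - Real.logb q (1 - ω)|
  set η := (qEntropy q ω - max (f1 q ω) (f2 q ω) - R₂) / 3 with hη
  have hη0 : 0 < η := by rw [hη]; linarith
  set c₁ := (1 - qEntropy q (δ + ω) - R₁) / 2 with hc₁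
  have hc₁0 : 0 < c₁ := by rw [hc₁]; linarith
  obtain ⟨s₁, hs₁, hf1⟩ := exists_slack_phi_le (ω := ω) (lo := ω ^ 2) (hi := 1 - (1 - ω) ^ 2)
    (D := delta1 q ω) (f := max (f1 q ω) (f2 q ω)) hq hη0
    fun γ α β h h1 h2 h3 => (phi_le_f1 hq h h1 h2 h3).trans (le_max_left _ _)
  obtain ⟨s₂, hs₂, hf2⟩ := exists_slack_phi_le (ω := ω) (lo := ω * ((q : ℝ) - 1) / q)
    (hi := 1 - (1 - ω) / q) (D := delta2 q ω) (f := max (f1 q ω) (f2 q ω)) hq hη0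
    fun γ α β h h1 h2 h3 => (phi_le_f2 hq h h1 h2 h3).trans (le_max_right _ _)
  have hcont : Filter.Tendsto (fun s : ℝ => qEntropy q (δ + ω + 2 * s)) (nhds 0)
      (nhds (qEntropy q (δ + ω))) := by
    have h0 : δ + ω + 2 * 0 = δ + ω := by ring
    have := continuousAt_qEntropy hq (x := δ + ω + 2 * 0) (by linarith) (by linarith)
    have h := ContinuousAt.comp (x := (0 : ℝ)) (f := fun s : ℝ => δ + ω + 2 * s) this (by fun_prop)
    simpa only [ContinuousAt, Function.comp_def, h0] using h
  have hlin : Filter.Tendsto (fun s : ℝ => δ + ω + 2 * s) (nhds 0) (nhds (δ + ω)) := by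
    have h : ContinuousAt (fun s : ℝ => δ + ω + 2 * s) 0 := by fun_prop
    simpa [ContinuousAt] using h
  have hL : Filter.Tendsto (fun s : ℝ => s * L) (nhds 0) (nhds 0) := by
    have h : ContinuousAt (fun s : ℝ => s * L) 0 := by fun_prop
    simpa [ContinuousAt] using h
  have hev : ∀ᶠ s in nhdsWithin (0 : ℝ) (Set.Ioi 0),
      s < s₁ ∧ s < s₂ ∧ qEntropy q (δ + ω + 2 * s) < 1 - R₁ - c₁ ∧
      δ + ω + 2 * s < ((q : ℝ) - 1) / q ∧ s * L < η := by
    refine Filter.Eventually.filter_mono nhdsWithin_le_nhds ?_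
    exact (Filter.Tendsto.eventually_lt_const hs₁ Filter.tendsto_id).and
      ((Filter.Tendsto.eventually_lt_const hs₂ Filter.tendsto_id).and
      ((hcont.eventually_lt_const (by rw [hc₁]; linarith)).and
      ((hlin.eventually_lt_const hlt).and (hL.eventually_lt_const hη0))))
  obtain ⟨s, ⟨hss₁, hss₂, hent, hρ, hsL⟩, hs⟩ := (hev.and self_mem_nhdsWithin).exists
  have hs0 : 0 < s := hs
  refine ⟨s, δ + ω + 2 * s, max (f1 q ω) (f2 q ω) + η, min c₁ η, hs0, lt_min hc₁0 hη0, le_rfl,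
    by linarith, hρ.le, ?_, ?_, hf1 s hss₁, hf2 s hss₂⟩
  · linarith [min_le_left c₁ η]
  · linarith [min_le_right c₁ η]

end Parameters

/-- Theorem 3 of the paper: if `ω ≥ 0` satisfies
`(t−1)/t·(1 − 1/q^{t−1}) + ω ≤ (q−1)/q`, `R₁ < 1 − h((t−1)/t·(1 − 1/q^{t−1}) + ω)`
and `R₂ < h(ω) − max(f₁(ω), f₂(ω))`, then `(R₁,R₂)` is achievable for `q`-ary
`(t,2)`-fingerprinting: for every `ε > 0` and all large enough `n`, there is an
`(n, ⌊q^{nR₁}⌋, ⌊q^{nR₂}⌋)_q` randomized code that is `(t,2)`-fingerprinting with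
`ε`-error. -/
theorem stmt16 (t q : ℕ) (ht : 3 ≤ t) (hq : 3 ≤ q)
    (R₁ R₂ : ℝ) (hR₁ : 0 ≤ R₁) (hR₂ : 0 ≤ R₂)
    (ω : ℝ) (hω0 : 0 ≤ ω)
    (hωb : ((t : ℝ) - 1) / t * (1 - 1 / (q : ℝ) ^ (t - 1)) + ω ≤ ((q : ℝ) - 1) / q)
    (h1 : R₁ < 1 - qEntropy q (((t : ℝ) - 1) / t * (1 - 1 / (q : ℝ) ^ (t - 1)) + ω))
    (h2 : R₂ < qEntropy q ω - max (f1 q ω) (f2 q ω)) :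
    ∀ ε : ℝ, 0 < ε → ∃ n₀ : ℕ, ∀ n : ℕ, n₀ ≤ n →
      ∃ 𝒞 : RandCode q n ⌊(q : ℝ) ^ ((n : ℝ) * R₁)⌋₊ ⌊(q : ℝ) ^ ((n : ℝ) * R₂)⌋₊,
        IsFingerprinting 𝒞 t 2 ε := by
  have : NeZero q := ⟨by omega⟩
  have hq' : (3 : ℝ) ≤ q := by exact_mod_cast hq
  have hq0 : (0 : ℝ) < q := by linarith
  obtain ⟨hω, hω1, s, ρ, M, c, hs, hc, hsρ, hρ0, hρq, hc₁, hc₂, hf1, hf2⟩ :=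
    exists_code_parameters ht hq hR₁ hR₂ hω0 hωb h1 h2
  intro ε hε
  obtain ⟨n₀, hn₀⟩ := Filter.eventually_atTop.1
    ((tendsto_error_bound hq (1 + 4 * t) 2 s hc).eventually_lt_const hε)
  refine ⟨n₀ + 1, fun n hn => ⟨randCodeOf hq hω.le hω1.le (keyCode ω s ρ), ?_⟩⟩
  have hpos : 0 < n := by omega
  have hn' : (0 : ℝ) ≤ n := Nat.cast_nonneg n
  have hbound := (hn₀ n (by omega)).le
  have hM₁ : (⌊(q : ℝ) ^ ((n : ℝ) * R₁)⌋₊ : ℝ) * (q : ℝ) ^ (-((n : ℝ) * (1 - qEntropy q ρ))) ≤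
      (q : ℝ) ^ (-((n : ℝ) * c)) := by
    refine (mul_le_mul_of_nonneg_right (Nat.floor_le (by positivity)) (by positivity)).trans ?_
    rw [← Real.rpow_add hq0]
    refine Real.rpow_le_rpow_of_exponent_le (by linarith) ?_
    nlinarith
  have hM₂ : 2 * (⌊(q : ℝ) ^ ((n : ℝ) * R₂)⌋₊ : ℝ) * (((n : ℝ) + 1) ^ 3 *
      ((q : ℝ) ^ ((n : ℝ) * M) * (q : ℝ) ^ (-((n : ℝ) * (qEntropy q ω -
        s * |Real.logb q (ω / ((q : ℝ) - 1)) - Real.logb q (1 - ω)|))))) ≤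
      2 * (((n : ℝ) + 1) ^ 3 * (q : ℝ) ^ (-((n : ℝ) * c))) := by
    refine (mul_le_mul_of_nonneg_right (mul_le_mul_of_nonneg_left
      (Nat.floor_le (by positivity)) two_pos.le) (by positivity)).trans ?_
    rw [mul_assoc, mul_left_comm _ (((n : ℝ) + 1) ^ 3), ← Real.rpow_add hq0,
      ← Real.rpow_add hq0]
    have : (n : ℝ) * R₂ + ((n : ℝ) * M + -((n : ℝ) * (qEntropy q ω -
        s * |Real.logb q (ω / ((q : ℝ) - 1)) - Real.logb q (1 - ω)|))) ≤ -((n : ℝ) * c) := by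
      nlinarith
    gcongr
    linarith
  have hM₂0 : 0 ≤ 2 * (((n : ℝ) + 1) ^ 3 * (q : ℝ) ^ (-((n : ℝ) * c))) := by positivity
  refine ⟨fun m hm hm2 u hu V hV => ?_, fun m hm hmt u hu V hV => ?_⟩
  · refine le_trans (e2_keyCode_le_of_injective hq hpos (by omega) hω hω1 hs hsρ hρ0 hρq hf1
      hf2 hm hm2 u hu hV) (le_trans ?_ hbound)
    gcongr
  · refine le_trans (e1_keyCode_le_of_injective hq hpos hω.le hω1.le hs hsρ hρ0 hρq hm hmt u
      hu hV) (le_trans ?_ hbound)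
    linarith
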